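/- arXiv:2401.14605 — 4 statements merged into one kernel-verified Lean document; each statement's English description precedes it below -/
import Mathlib

section
/- Let X be a standard Borel space and let E be an aperiodic, countable Borel equivalence relation on X. For any integers n, k > 1, if the weak Borel Ramsey property E →*_B (E)^n_k holds, then the strong Borel Ramsey property E →_B (E)^n_k holds. -/
open Classical

noncomputable section

/-- `Y` is a complete section for `E`: it meets every `E`-class. -/
def IsCompleteSection {X : Type*} (E : X → X → Prop) (Y : Set X) : Prop :=
  ∀ x : X, ∃ y ∈ Y, E x y

/-- `Y` is an infinite complete section for `E`: it meets every `E`-class in an infinite set. -/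
def IsInfiniteCompleteSection {X : Type*} (E : X → X → Prop) (Y : Set X) : Prop :=
  ∀ x : X, {y | y ∈ Y ∧ E x y}.Infinite

/-- A coloring `c` of the `n`-element subsets of single `E`-classes (encoded as a function on
finsets) is `E`-monochromatic on `Y`: for every `x` there is a color `a` such that every
`n`-element subset of `Y` contained in `[x]_E` gets color `a`. -/
def IsMonochromatic {X : Type*} (E : X → X → Prop) (n : ℕ) {k : ℕ}
    (c : Finset X → Fin k) (Y : Set X) : Prop :=
  ∀ x : X, ∃ a : Fin k, ∀ A : Finset X, A.card = n → ↑A ⊆ Y → (∀ y ∈ A, E x y) → c A = a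

/-- `c` is a Borel coloring of dimension `n`: the induced map on `n`-tuples is measurable. -/
def IsBorelColoring {X : Type*} [MeasurableSpace X] (n : ℕ) {k : ℕ}
    (c : Finset X → Fin k) : Prop :=
  Measurable fun v : Fin n → X => c (Set.finite_range v).toFinset

/-- The strong Borel Ramsey property `E →_B (E)^n_k`: every Borel `E`-coloring of dimension
`n` by `k` colors admits a Borel `E`-monochromatic infinite complete section. -/
def StrongBorelRamsey {X : Type*} [MeasurableSpace X] (E : X → X → Prop) (n k : ℕ) : Prop :=
  ∀ c : Finset X → Fin k, IsBorelColoring n c →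
    ∃ Y : Set X, MeasurableSet Y ∧ IsInfiniteCompleteSection E Y ∧ IsMonochromatic E n c Y

/-- The weak Borel Ramsey property `E →*_B (E)^n_k`: every Borel `E`-coloring of dimension
`n` by `k` colors admits a Borel `E`-monochromatic complete section. -/
def WeakBorelRamsey {X : Type*} [MeasurableSpace X] (E : X → X → Prop) (n k : ℕ) : Prop :=
  ∀ c : Finset X → Fin k, IsBorelColoring n c →
    ∃ Y : Set X, MeasurableSet Y ∧ IsCompleteSection E Y ∧ IsMonochromatic E n c Y

/-- `E` is smooth: Borel reducible to equality on a standard Borel space. -/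
def IsSmooth {X : Type*} [MeasurableSpace X] (E : X → X → Prop) : Prop :=
  ∃ (Z : Type) (mZ : MeasurableSpace Z), @StandardBorelSpace Z mZ ∧
    ∃ f : X → Z, @Measurable X Z _ mZ f ∧ ∀ x y : X, E x y ↔ f x = f y

/-- The eventual agreement relation `E₀` on Cantor space `2^ℕ`. -/
def E0 (x y : ℕ → Bool) : Prop := ∃ n : ℕ, ∀ m ≥ n, x m = y m

/-- `Σ_{i<δ(x,y)} x i + Σ_{i<δ(x,y)} y i`, where `δ(x,y)` is the least `n` with
`x m = y m` for all `m ≥ n`; junk value `0` if `x` and `y` are not `E₀`-related. -/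
def colorSum (x y : ℕ → Bool) : ℕ :=
  if h : ∃ n : ℕ, ∀ m ≥ n, x m = y m then
    ((Finset.range (Nat.find h)).sum fun i => (x i).toNat) +
    ((Finset.range (Nat.find h)).sum fun i => (y i).toNat)
  else 0

/-- The coloring `c` of the paper: a pair `{x,y}` of distinct `E₀`-related points gets color
`0` (representing color `1`) if `colorSum x y` is even, and color `1` (representing color `2`)
otherwise. -/
def c0 : Finset (ℕ → Bool) → Fin 2 := fun A =>
  if ∃ x y : ℕ → Bool, x ≠ y ∧ A = {x, y} ∧ E0 x y ∧ Even (colorSum x y) then 0 else 1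

/-- The subrelation `F` of `E₀`: `x F y` iff `x = y` or `c ({x,y}) = 1` (even `colorSum`). -/
def F0 (x y : ℕ → Bool) : Prop := x = y ∨ (E0 x y ∧ Even (colorSum x y))

/-- The map flipping coordinate `0`. -/
def flip0 (x : ℕ → Bool) : ℕ → Bool := fun n => if n = 0 then !(x 0) else x n

/-- Eventual agreement of `X`-valued sequences: the relation `E₀(X)` on `X^ℕ`
(denoted `E₁` when `X` is uncountable). -/
def E1rel {X : Type*} (u v : ℕ → X) : Prop := ∃ N : ℕ, ∀ j ≥ N, u j = v j

/-- `S` is a monochromatic reduction to `E₁` for the coloring `c` of dimension `n`: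
each `S x` is injective, its range is a monochromatic subset of `[x]_E`, and
`x E y ↔ S x E₁ S y`. -/
def IsMonochromaticReduction {X : Type*} (E : X → X → Prop) (n : ℕ) {k : ℕ}
    (c : Finset X → Fin k) (S : X → ℕ → X) : Prop :=
  (∀ x : X, Function.Injective (S x)) ∧
  (∀ x : X, (∀ i : ℕ, E x (S x i)) ∧
    ∃ a : Fin k, ∀ A : Finset X, A.card = n → ↑A ⊆ Set.range (S x) → c A = a) ∧
  (∀ x y : X, E x y ↔ E1rel (S x) (S y))

/-- `c` is an almost transitive coloring of dimension `n` for `E`: for every `m ≥ n`, every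
`A ∈ [X]^m_E` and all `(n-1)`-element subsets `B₁, B₂ ⊆ A`, one has
`c ({z} ∪ B₁) = c ({z} ∪ B₂)` for all but finitely many `z` in the `E`-saturation of `A`
outside `B₁ ∪ B₂`. -/
def AlmostTransitive {X : Type*} (E : X → X → Prop) (n : ℕ) {k : ℕ}
    (c : Finset X → Fin k) : Prop :=
  ∀ m : ℕ, n ≤ m → ∀ A : Finset X, A.card = m → (∀ x ∈ A, ∀ y ∈ A, E x y) →
    ∀ B₁ B₂ : Finset X, B₁ ⊆ A → B₂ ⊆ A → B₁.card = n - 1 → B₂.card = n - 1 →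
      {z : X | (∃ a ∈ A, E a z) ∧ z ∉ B₁ ∪ B₂ ∧ c (insert z B₁) ≠ c (insert z B₂)}.Finite


theorem exists_measurable_choice {Z ι : Type*} [MeasurableSpace Z] [Countable ι] [MeasurableSpace ι]
    (p : Z → ι → Prop) (hp : ∀ z, ∃ i, p z i) (hm : ∀ i, MeasurableSet {z | p z i}) :
    ∃ t : Z → ι, Measurable t ∧ ∀ z, p z (t z) := by
  rcases isEmpty_or_nonempty Z with hZ | ⟨⟨z0⟩⟩
  · exact ⟨fun z => (hp z).choose, measurable_of_empty _, fun z => (hp z).choose_spec⟩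
  have : Nonempty ι := ⟨(hp z0).choose⟩
  obtain ⟨e, he⟩ := exists_surjective_nat ι
  have hq : ∀ z, ∃ m, p z (e m) := fun z => by
    obtain ⟨i, hi⟩ := hp z
    obtain ⟨m, rfl⟩ := he i
    exact ⟨m, hi⟩
  refine ⟨fun z => e (Nat.find (hq z)), ?_, fun z => Nat.find_spec (hq z)⟩
  exact (measurable_from_nat (f := e)).comp (measurable_find hq (fun m => hm (e m)))

/-- measurable refinement of an infinite set to one colour -/
theorem ramsey_refine {Z : Type*} [MeasurableSpace Z] {k : ℕ}
    (H : Z → Set ℕ) (hHm : ∀ b, MeasurableSet {z | b ∈ H z}) (hHi : ∀ z, (H z).Infinite)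
    (g : ℕ → Z → Fin k) (hg : ∀ b, Measurable (g b)) :
    ∃ t : Z → Fin k, Measurable t ∧ ∀ z, {b | b ∈ H z ∧ g b z = t z}.Infinite := by
  refine exists_measurable_choice (fun z i => {b | b ∈ H z ∧ g b z = i}.Infinite) ?_ ?_
  · intro z
    by_contra! hcon
    refine hHi z ((Set.finite_iUnion hcon).subset ?_)
    intro b hb
    exact Set.mem_iUnion.2 ⟨g b z, hb, rfl⟩
  · intro i
    have : {z | {b | b ∈ H z ∧ g b z = i}.Infinite}
        = ⋂ N : ℕ, ⋃ b : ℕ, {z | N < b ∧ b ∈ H z ∧ g b z = i} := by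
      ext z
      simp only [Set.mem_ofPred_eq, Set.mem_iInter, Set.mem_iUnion]
      constructor
      · intro h N
        obtain ⟨b, hb, hN⟩ := h.exists_gt N
        exact ⟨b, hN, hb⟩
      · intro h
        refine Set.infinite_of_forall_exists_gt fun N => ?_
        obtain ⟨b, hN, hb⟩ := h N
        exact ⟨b, hb, hN⟩
    rw [this]
    refine MeasurableSet.iInter fun N => MeasurableSet.iUnion fun b => ?_
    exact (MeasurableSet.const _).inter ((hHm b).inter (hg b (measurableSet_singleton i)))

/-- the diagonal set -/
def diagSet (K : ℕ → Set ℕ) (b : ℕ) : Prop :=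
  b ∈ K 0 ∧ ∀ a : ℕ, a < b → diagSet K a → b ∈ K (a + 1)
termination_by b

theorem ramsey_measurable {Z : Type*} [MeasurableSpace Z] {k : ℕ} (n : ℕ) :
    ∀ (c : Finset ℕ → Z → Fin k) (_ : ∀ A, Measurable (c A))
    (H : Z → Set ℕ) (_ : ∀ b, MeasurableSet {z | b ∈ H z}) (_ : ∀ z, (H z).Infinite),
    ∃ H' : Z → Set ℕ, (∀ b, MeasurableSet {z | b ∈ H' z}) ∧ (∀ z, (H' z).Infinite) ∧
      (∀ z, H' z ⊆ H z) ∧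
      ∀ z, ∃ a : Fin k, ∀ A : Finset ℕ, A.card = n → ↑A ⊆ H' z → c A z = a := by
  induction n with
  | zero =>
    intro c hc H hHm hHi
    refine ⟨H, hHm, hHi, fun z => subset_rfl, fun z => ⟨c ∅ z, fun A hA _ => ?_⟩⟩
    rw [Finset.card_eq_zero.1 hA]
  | succ n ih =>
    intro c hc H hHm hHi
    -- states
    let St := {K : Z → Set ℕ // (∀ b, MeasurableSet {z | b ∈ K z}) ∧ ∀ z, (K z).Infinite}
    have hstep : ∀ (A : Finset ℕ) (K : St), ∃ t : Z → Fin k, Measurable t ∧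
        ∀ z, {b | b ∈ K.1 z ∧ c (insert b A) z = t z}.Infinite := fun A K =>
      ramsey_refine K.1 K.2.1 K.2.2 (fun b => c (insert b A)) (fun b => hc _)
    choose t htm hti using hstep
    let nxt : Finset ℕ → St → St := fun A K =>
      ⟨fun z => {b | b ∈ K.1 z ∧ c (insert b A) z = t A K z}, fun b =>
        (K.2.1 b).inter (measurableSet_eq_fun (hc _) (htm A K)), hti A K⟩
    -- sequence of states along an enumeration of finsets
    let e : ℕ ≃ Finset ℕ := (Denumerable.eqv (Finset ℕ)).symm
    let seq : ℕ → St := fun m => Nat.rec ⟨H, hHm, hHi⟩ (fun m K => nxt (e m) K) m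
    have hseq : ∀ m, seq (m + 1) = nxt (e m) (seq m) := fun m => rfl
    have hanti : ∀ z, Antitone (fun m => (seq m).1 z) := fun z =>
      antitone_nat_of_succ_le fun m => by
        rw [hseq]; exact fun b hb => hb.1
    let c' : Finset ℕ → Z → Fin k := fun A => t A (seq (e.symm A))
    have hcol : ∀ A z m, e.symm A < m → ∀ b ∈ (seq m).1 z, c (insert b A) z = c' A z := by
      intro A z m hm b hb
      have h1 : b ∈ (seq (e.symm A + 1)).1 z := hanti z (Nat.succ_le_of_lt hm) hb
      rw [hseq] at h1
      have := h1.2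
      simpa [c'] using this
    let Θ : ℕ → ℕ := fun a => (Finset.range a).powerset.sup (fun A => e.symm A + 1)
    have hΘm : Monotone Θ := fun a b hab =>
      Finset.sup_mono (Finset.powerset_mono.2 (Finset.range_subset_range.2 hab))
    let D : Z → Set ℕ := fun z => {b | diagSet (fun a => (seq (Θ a)).1 z) b}
    have hDiff : ∀ z b, b ∈ D z ↔ b ∈ (seq (Θ 0)).1 z ∧ ∀ a < b, a ∈ D z → b ∈ (seq (Θ (a+1))).1 z := by
      intro z b
      show diagSet _ b ↔ _
      rw [diagSet]
      rfl
    have hDm : ∀ b, MeasurableSet {z | b ∈ D z} := by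
      intro b
      induction b using Nat.strong_induction_on with
      | _ b ihb =>
        have hset : {z | b ∈ D z} = {z | b ∈ (seq (Θ 0)).1 z} ∩
            ⋂ a : ℕ, ⋂ _ : a < b, {z | a ∈ D z → b ∈ (seq (Θ (a+1))).1 z} := by
          ext z
          simp only [Set.mem_ofPred_eq, Set.mem_inter_iff, Set.mem_iInter]
          exact hDiff z b
        rw [hset]
        refine MeasurableSet.inter ((seq (Θ 0)).2.1 b) ?_
        refine MeasurableSet.iInter fun a => MeasurableSet.iInter fun hab => ?_
        have : {z | a ∈ D z → b ∈ (seq (Θ (a+1))).1 z} = {z | a ∈ D z}ᶜ ∪ {z | b ∈ (seq (Θ (a+1))).1 z} := by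
          ext z; simp [imp_iff_not_or]
        rw [this]
        exact (ihb a hab).compl.union ((seq _).2.1 b)
    have hDi : ∀ z, (D z).Infinite := by
      intro z hfin
      obtain ⟨N, hN⟩ := hfin.bddAbove
      obtain ⟨b, hb, hNb⟩ := ((seq (Θ (N + 1))).2.2 z).exists_gt N
      have : b ∈ D z := by
        rw [hDiff]
        refine ⟨hanti z (hΘm (Nat.zero_le _)) hb, fun a _ ha => hanti z (hΘm ?_) hb⟩
        exact Nat.succ_le_succ (hN ha)
      exact absurd (hN this) (not_le.2 hNb)
    obtain ⟨H', hm', hi', hsub', hmono'⟩ := ih c' (fun A => htm _ _) D hDm hDi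
    refine ⟨H', hm', hi', fun z => (hsub' z).trans ?_, fun z => ?_⟩
    · intro b hb
      have := ((hDiff z b).1 hb).1
      exact hanti z (Nat.zero_le (Θ 0)) this
    · obtain ⟨a, ha⟩ := hmono' z
      refine ⟨a, fun A hA hAs => ?_⟩
      have hne : A.Nonempty := Finset.card_pos.1 (by omega)
      set b := A.max' hne with hb
      have hbA : b ∈ A := A.max'_mem hne
      have hlt : ∀ x ∈ A.erase b, x < b := fun x hx =>
        lt_of_le_of_ne (A.le_max' x (Finset.mem_of_mem_erase hx)) (Finset.ne_of_mem_erase hx)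
      have hcard : (A.erase b).card = n := by rw [Finset.card_erase_of_mem hbA]; omega
      have hsub2 : ↑(A.erase b) ⊆ H' z := fun x hx => hAs (Finset.mem_of_mem_erase hx)
      rw [← ha _ hcard hsub2, ← Finset.insert_erase hbA]
      rw [Finset.erase_insert (Finset.notMem_erase b A)]
      have hbD := (hDiff z b).1 (hsub' z (hAs hbA))
      rcases (A.erase b).eq_empty_or_nonempty with h0 | h0
      · rw [h0]
        refine hcol ∅ z (Θ 0) ?_ b hbD.1
        exact Nat.lt_of_succ_le (Finset.le_sup (f := fun A => e.symm A + 1) (by simp))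
      · set a' := (A.erase b).max' h0 with ha'
        have hmem : a' ∈ A.erase b := Finset.max'_mem _ _
        refine hcol _ z (Θ (a' + 1)) ?_ b (hbD.2 a' (hlt _ hmem) (hsub' z (hsub2 hmem)))
        refine Nat.lt_of_succ_le (Finset.le_sup (f := fun A => e.symm A + 1) ?_)
        rw [Finset.mem_powerset]
        intro x hx
        exact Finset.mem_range.2 (Nat.lt_succ_of_le (Finset.le_max' _ x hx))

/-- `G` is a countable union of Borel graphs of partial functions. -/
def IsGraphUnion {X Y : Type*} [MeasurableSpace X] [MeasurableSpace Y] (G : Set (X × Y)) : Prop :=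
  ∃ g : ℕ → Set (X × Y), (∀ j, MeasurableSet (g j)) ∧
    (∀ j x y y', (x, y) ∈ g j → (x, y') ∈ g j → y = y') ∧ G = ⋃ j, g j

theorem IsGraphUnion.measurableSet {X Y : Type*} [MeasurableSpace X] [MeasurableSpace Y]
    {G : Set (X × Y)} (h : IsGraphUnion G) : MeasurableSet G := by
  obtain ⟨g, hm, -, rfl⟩ := h
  exact MeasurableSet.iUnion hm

theorem IsGraphUnion.empty {X Y : Type*} [MeasurableSpace X] [MeasurableSpace Y] :
    IsGraphUnion (∅ : Set (X × Y)) :=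
  ⟨fun _ => ∅, fun _ => MeasurableSet.empty, by simp, by simp⟩

theorem IsGraphUnion.of_graph {X Y : Type*} [MeasurableSpace X] [MeasurableSpace Y]
    {G : Set (X × Y)} (hm : MeasurableSet G)
    (hf : ∀ x y y', (x, y) ∈ G → (x, y') ∈ G → y = y') : IsGraphUnion G :=
  ⟨fun _ => G, fun _ => hm, fun _ => hf, (Set.iUnion_const G).symm⟩

theorem IsGraphUnion.iUnion {X Y ι : Type*} [MeasurableSpace X] [MeasurableSpace Y] [Countable ι]
    {G : ι → Set (X × Y)} (h : ∀ i, IsGraphUnion (G i)) : IsGraphUnion (⋃ i, G i) := by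
  rcases isEmpty_or_nonempty ι with hι | hι
  · simpa using IsGraphUnion.empty
  choose g hm hf hG using h
  obtain ⟨e, he⟩ := exists_surjective_nat (ι × ℕ)
  refine ⟨fun m => g (e m).1 (e m).2, fun m => hm _ _, fun m => hf _ _, ?_⟩
  ext p
  simp only [Set.mem_iUnion, hG]
  constructor
  · rintro ⟨i, j, h⟩
    obtain ⟨m, hm⟩ := he (i, j)
    exact ⟨m, by rw [hm]; exact h⟩
  · rintro ⟨m, h⟩
    exact ⟨_, _, h⟩

theorem IsGraphUnion.union {X Y : Type*} [MeasurableSpace X] [MeasurableSpace Y]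
    {G G' : Set (X × Y)} (h : IsGraphUnion G) (h' : IsGraphUnion G') : IsGraphUnion (G ∪ G') := by
  rw [Set.union_eq_iUnion]
  exact IsGraphUnion.iUnion (fun b => by cases b <;> assumption)

theorem analyticSet_inter' {X : Type*} [TopologicalSpace X] [T2Space X] {A B : Set X}
    (hA : MeasureTheory.AnalyticSet A) (hB : MeasureTheory.AnalyticSet B) :
    MeasureTheory.AnalyticSet (A ∩ B) := by
  rw [Set.inter_eq_iInter]
  exact MeasureTheory.AnalyticSet.iInter (fun b => by cases b <;> assumption)

/-- An analytic graph of a partial function is contained in a Borel one. -/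
theorem analytic_graph_subset {X Y : Type*} [TopologicalSpace X] [PolishSpace X]
    [MeasurableSpace X] [BorelSpace X] [TopologicalSpace Y] [PolishSpace Y]
    [MeasurableSpace Y] [BorelSpace Y] (S : Set (X × Y)) (hS : MeasureTheory.AnalyticSet S)
    (hf : ∀ x y y', (x, y) ∈ S → (x, y') ∈ S → y = y') :
    ∃ G : Set (X × Y), S ⊆ G ∧ IsGraphUnion G := by
  obtain ⟨e, he⟩ := MeasureTheory.exists_measurableEmbedding_real Y
  have hV : ∀ q : ℚ, MeasurableSet {p : X × Y | e p.2 < q} := fun q =>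
    measurableSet_lt (he.measurable.comp measurable_snd) measurable_const
  have hsep : ∀ q : ℚ, MeasureTheory.MeasurablySeparable
      (Prod.fst '' (S ∩ {p : X × Y | e p.2 < q})) (Prod.fst '' (S ∩ {p : X × Y | e p.2 < q}ᶜ)) := by
    intro q
    refine MeasureTheory.AnalyticSet.measurablySeparable
      ((analyticSet_inter' hS (hV q).analyticSet).image_of_continuous continuous_fst)
      ((analyticSet_inter' hS (hV q).compl.analyticSet).image_of_continuous continuous_fst) ?_
    rw [Set.disjoint_left]
    rintro _ ⟨⟨x, y⟩, ⟨h1, h2⟩, rfl⟩ ⟨⟨x', y'⟩, ⟨h3, h4⟩, heq⟩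
    simp only at heq
    subst heq
    have := hf _ _ _ h1 h3
    subst this
    exact h4 h2
  choose B hB1 hB2 hBm using hsep
  refine ⟨⋂ q : ℚ, {p : X × Y | p.1 ∈ B q ↔ e p.2 < q}, ?_, IsGraphUnion.of_graph ?_ ?_⟩
  · intro p hp
    refine Set.mem_iInter.2 fun q => ⟨fun h => ?_, fun h => hB1 q ⟨p, ⟨hp, h⟩, rfl⟩⟩
    by_contra hn
    exact Set.disjoint_left.1 (hB2 q) ⟨p, ⟨hp, hn⟩, rfl⟩ h
  · refine MeasurableSet.iInter fun q => ?_
    have h1 : MeasurableSet {p : X × Y | p.1 ∈ B q} := measurable_fst (hBm q)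
    exact h1.iff (hV q)
  · intro x y y' h1 h2
    apply he.injective
    have key : ∀ q : ℚ, e y < q ↔ e y' < q := fun q =>
      (Set.mem_iInter.1 h1 q).symm.trans (Set.mem_iInter.1 h2 q)
    refine le_antisymm ?_ ?_
    · refine le_of_forall_gt_imp_ge_of_dense fun a ha => ?_
      obtain ⟨q, hq1, hq2⟩ := exists_rat_btwn ha
      exact (((key q).2 hq1).trans hq2).le
    · refine le_of_forall_gt_imp_ge_of_dense fun a ha => ?_
      obtain ⟨q, hq1, hq2⟩ := exists_rat_btwn ha
      exact (((key q).1 hq1).trans hq2).le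

/-- finite sequences of naturals -/
abbrev NNode := Σ n : ℕ, (Fin n → ℕ)

def ncyl (t : NNode) : Set (ℕ → ℕ) := {b | ∀ i : Fin t.1, b i = t.2 i}

def nres (b : ℕ → ℕ) (n : ℕ) : NNode := ⟨n, fun i => b i⟩

theorem mem_ncyl_nres (b : ℕ → ℕ) (n : ℕ) : b ∈ ncyl (nres b n) := fun _ => rfl

theorem isClosed_ncyl (t : NNode) : IsClosed (ncyl t) := by
  have : ncyl t = ⋂ i : Fin t.1, {b : ℕ → ℕ | b i = t.2 i} := by
    ext b; simp [ncyl]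
  rw [this]
  exact isClosed_iInter fun i => isClosed_eq (continuous_apply _) continuous_const

theorem ncyl_nres_subset {t : NNode} {b : ℕ → ℕ} (hb : b ∈ ncyl t) {n : ℕ} (hn : t.1 ≤ n) :
    ncyl (nres b n) ⊆ ncyl t := by
  intro d hd i
  rw [← hb i]
  exact hd ⟨i, lt_of_lt_of_le i.2 hn⟩

theorem ncyl_subset_nres {t : NNode} {b : ℕ → ℕ} (hb : b ∈ ncyl t) {n : ℕ} (hn : n ≤ t.1) :
    ncyl t ⊆ ncyl (nres b n) := by
  intro d hd i
  have h1 := hd ⟨i, lt_of_lt_of_le i.2 hn⟩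
  have h2 := hb ⟨i, lt_of_lt_of_le i.2 hn⟩
  exact h1.trans h2.symm

theorem exists_ncyl_subset {U : Set (ℕ → ℕ)} (hU : IsOpen U) {b : ℕ → ℕ} (hb : b ∈ U) :
    ∃ n, ∀ m ≥ n, ncyl (nres b m) ⊆ U := by
  obtain ⟨s, ⟨x, n, rfl⟩, hbs, hsU⟩ :=
    (PiNat.isTopologicalBasis_cylinders (fun _ : ℕ => ℕ)).exists_subset_of_mem_open hb hU
  refine ⟨n, fun m hm d hd => hsU ?_⟩
  intro i hi
  rw [← hbs i hi]
  exact hd ⟨i, lt_of_lt_of_le hi hm⟩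

section LN
set_option linter.unusedSectionVars false
variable {X Y : Type*} [TopologicalSpace X] [PolishSpace X]
    [MeasurableSpace X] [BorelSpace X] [TopologicalSpace Y] [PolishSpace Y]
    [MeasurableSpace Y] [BorelSpace Y]

def NBig (φ : (ℕ → ℕ) → X × Y) (T : Finset NNode) : Prop :=
  ∀ G : Set (X × Y), IsGraphUnion G → ∃ x : X, ∀ t ∈ T, ∃ b ∈ ncyl t, (φ b).1 = x ∧ φ b ∉ G

theorem NBig.mono {φ : (ℕ → ℕ) → X × Y} {T T' : Finset NNode} (h : NBig φ T) (hs : T' ⊆ T) :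
    NBig φ T' := fun G hG => by
  obtain ⟨x, hx⟩ := h G hG
  exact ⟨x, fun t ht => hx t (hs ht)⟩

/-- `t0`, `t1` is a good splitting of `t`. -/
def NGood (φ : (ℕ → ℕ) → X × Y) (t t0 t1 : NNode) : Prop :=
  ncyl t0 ⊆ ncyl t ∧ ncyl t1 ⊆ ncyl t ∧ t.1 < t0.1 ∧ t.1 < t1.1 ∧
    ∀ b0 ∈ ncyl t0, ∀ b1 ∈ ncyl t1, (φ b0).2 ≠ (φ b1).2

theorem NBig.split {φ : (ℕ → ℕ) → X × Y} (hφ : Continuous φ) {T : Finset NNode} {t : NNode}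
    (h : NBig φ (insert t T)) :
    ∃ t0 t1, NGood φ t t0 t1 ∧ NBig φ (insert t0 (insert t1 T)) := by
  by_contra! hcon
  have h1 : ∀ q : NNode × NNode, ∃ G : Set (X × Y), IsGraphUnion G ∧ (NGood φ t q.1 q.2 →
      ¬ ∃ x : X, ∀ s ∈ insert q.1 (insert q.2 T), ∃ b ∈ ncyl s, (φ b).1 = x ∧ φ b ∉ G) := by
    intro q
    by_cases hq : NGood φ t q.1 q.2
    · have := hcon _ _ hq
      unfold NBig at this
      push Not at this
      obtain ⟨G, hG, h2⟩ := this
      refine ⟨G, hG, fun _ h3 => ?_⟩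
      obtain ⟨x, hx⟩ := h3
      obtain ⟨s, hs, h4⟩ := h2 x
      obtain ⟨b, hb, hb1, hb2⟩ := hx s hs
      exact hb2 (h4 b hb hb1)
    · exact ⟨∅, IsGraphUnion.empty, fun h => absurd h hq⟩
  choose Gq hGq hGq2 using h1
  set G : Set (X × Y) := ⋃ q, Gq q with hGdef
  have hG : IsGraphUnion G := IsGraphUnion.iUnion hGq
  let P : NNode → Set (X × Y) := fun s => φ '' (ncyl s ∩ φ ⁻¹' Gᶜ)
  have hP : ∀ s, MeasureTheory.AnalyticSet (P s) := fun s =>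
    MeasurableSet.analyticSet_image ((isClosed_ncyl s).measurableSet.inter
      (hφ.measurable hG.measurableSet.compl)) hφ.measurable
  let W := insert t T
  let Q : Set X := ⋂ s : W, Prod.fst '' (P s)
  have : Nonempty W := ⟨⟨t, Finset.mem_insert_self _ _⟩⟩
  have hQ : MeasureTheory.AnalyticSet Q :=
    MeasureTheory.AnalyticSet.iInter fun s => (hP s).image_of_continuous continuous_fst
  let S : Set (X × Y) := ⋂ b : Bool, cond b (P t) (Prod.fst ⁻¹' Q)
  have hS : MeasureTheory.AnalyticSet S := by
    refine MeasureTheory.AnalyticSet.iInter fun b => ?_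
    cases b
    · exact hQ.preimage continuous_fst
    · exact hP t
  have hSmem : ∀ p, p ∈ S ↔ p ∈ P t ∧ p.1 ∈ Q := by
    intro p
    simp only [S, Set.mem_iInter, Bool.forall_bool, cond_true, cond_false, Set.mem_preimage]
    tauto
  by_cases hfun : ∀ x y y', (x, y) ∈ S → (x, y') ∈ S → y = y'
  · obtain ⟨G', hSG', hG'⟩ := analytic_graph_subset S hS hfun
    obtain ⟨x, hx⟩ := h (G ∪ G') (hG.union hG')
    obtain ⟨b, hb, hb1, hb2⟩ := hx t (Finset.mem_insert_self _ _)
    apply hb2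
    right
    apply hSG'
    rw [hSmem]
    refine ⟨⟨b, ⟨hb, fun h => hb2 (Or.inl h)⟩, rfl⟩, ?_⟩
    refine Set.mem_iInter.2 fun s => ?_
    obtain ⟨d, hd, hd1, hd2⟩ := hx s.1 s.2
    exact ⟨φ d, ⟨d, ⟨hd, fun h => hd2 (Or.inl h)⟩, rfl⟩, hd1.trans hb1.symm⟩
  · push Not at hfun
    obtain ⟨x, y, y', hy, hy', hne⟩ := hfun
    rw [hSmem] at hy hy'
    obtain ⟨⟨b, ⟨hb, hbG⟩, hbe⟩, hxQ⟩ := hy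
    obtain ⟨⟨b', ⟨hb', hbG'⟩, hbe'⟩, -⟩ := hy'
    obtain ⟨U, U', hU, hU', hyU, hyU', hdis⟩ := t2_separation hne
    obtain ⟨m, hm⟩ := exists_ncyl_subset (hU.preimage (continuous_snd.comp hφ)) (b := b)
      (by simpa [hbe] using hyU)
    obtain ⟨m', hm'⟩ := exists_ncyl_subset (hU'.preimage (continuous_snd.comp hφ)) (b := b')
      (by simpa [hbe'] using hyU')
    let N := max (t.1 + 1) (max m m')
    have hN1 : t.1 + 1 ≤ N := le_max_left _ _
    have hgood : NGood φ t (nres b N) (nres b' N) := by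
      refine ⟨ncyl_nres_subset hb (by omega), ncyl_nres_subset hb' (by omega), hN1, hN1, ?_⟩
      intro b0 h0 b1 h1 heq
      have h0' := hm N (by omega) h0
      have h1' := hm' N (by omega) h1
      simp only [Set.mem_preimage, Function.comp] at h0' h1'
      rw [heq] at h0'
      exact Set.disjoint_left.1 hdis h0' h1'
    have hsub : Gq (nres b N, nres b' N) ⊆ G := Set.subset_iUnion Gq (nres b N, nres b' N)
    refine hGq2 (nres b N, nres b' N) hgood ⟨x, fun s hs => ?_⟩
    rw [Finset.mem_insert, Finset.mem_insert] at hs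
    rcases hs with rfl | rfl | hs
    · exact ⟨b, mem_ncyl_nres _ _, by rw [hbe], fun h => hbG (hsub h)⟩
    · exact ⟨b', mem_ncyl_nres _ _, by rw [hbe'], fun h => hbG' (hsub h)⟩
    · obtain ⟨p, ⟨d, ⟨hd, hdG⟩, rfl⟩, hp⟩ := Set.mem_iInter.1 hxQ ⟨s, Finset.mem_insert_of_mem hs⟩
      exact ⟨d, hd, hp, fun h => hdG (hsub h)⟩

theorem NBig.splitAll {φ : (ℕ → ℕ) → X × Y} (hφ : Continuous φ) (S : Finset NNode) :
    ∀ T : Finset NNode, NBig φ (S ∪ T) → ∃ (T' : Finset NNode) (ch : NNode → Bool → NNode),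
      NBig φ T' ∧ T ⊆ T' ∧ ∀ t ∈ S, (∀ b, ch t b ∈ T') ∧ NGood φ t (ch t false) (ch t true) := by
  induction S using Finset.induction_on with
  | empty =>
    intro T hT
    exact ⟨T, fun t _ => t, by simpa using hT, subset_rfl, by simp⟩
  | insert s S hs ih =>
    intro T hT
    rw [Finset.insert_union] at hT
    obtain ⟨s0, s1, hg, hb⟩ := hT.split hφ
    obtain ⟨T', ch, hT', hsub, hch⟩ := ih (insert s0 (insert s1 T)) (hb.mono (by
      intro a ha; simp only [Finset.mem_insert, Finset.mem_union] at ha ⊢; tauto))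
    refine ⟨T', Function.update ch s (fun b => cond b s1 s0), hT', ?_, ?_⟩
    · exact fun a ha => hsub (by simp [ha])
    · intro t ht
      rcases eq_or_ne t s with rfl | hne
      · simp only [Function.update_self, cond_true, cond_false]
        refine ⟨fun b => ?_, hg⟩
        cases b
        · exact hsub (by simp)
        · exact hsub (by simp)
      · rw [Function.update_of_ne hne]
        exact hch t ((Finset.mem_insert.1 ht).resolve_left hne)

theorem lusin_novikov_cover {φ : (ℕ → ℕ) → X × Y} (hφ : Continuous φ)
    (hc : ∀ x : X, {y | (x, y) ∈ Set.range φ}.Countable) :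
    ∃ G : Set (X × Y), IsGraphUnion G ∧ Set.range φ ⊆ G := by
  by_contra! hcon
  let root : NNode := ⟨0, fun i => i.elim0⟩
  have hroot : NBig φ {root} := by
    intro G hG
    obtain ⟨p, ⟨b, rfl⟩, hp⟩ := Set.not_subset.1 (hcon G hG)
    refine ⟨(φ b).1, fun t ht => ⟨b, ?_, rfl, hp⟩⟩
    rw [Finset.mem_singleton.1 ht]
    exact fun i => i.elim0
  have hstep : ∀ T : {T : Finset NNode // NBig φ T}, ∃ (T' : {T : Finset NNode // NBig φ T})
      (ch : NNode → Bool → NNode),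
      ∀ t ∈ T.1, (∀ b, ch t b ∈ T'.1) ∧ NGood φ t (ch t false) (ch t true) := by
    intro T
    obtain ⟨T', ch, h1, -, h2⟩ := NBig.splitAll hφ T.1 ∅ (by simpa using T.2)
    exact ⟨⟨T', h1⟩, ch, h2⟩
  choose nxt ch hch using hstep
  let seq : ℕ → {T : Finset NNode // NBig φ T} := fun n => Nat.rec ⟨{root}, hroot⟩ (fun _ T => nxt T) n
  have hseq : ∀ n, seq (n + 1) = nxt (seq n) := fun n => rfl
  let p : (ℕ → Bool) → ℕ → NNode := fun w n => Nat.rec root (fun n t => ch (seq n) t (w n)) n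
  have hp : ∀ w n, p w (n + 1) = ch (seq n) (p w n) (w n) := fun w n => rfl
  have hmem : ∀ w n, p w n ∈ (seq n).1 := by
    intro w n
    induction n with
    | zero => exact Finset.mem_singleton_self root
    | succ n ih => rw [hp, hseq]; exact (hch _ _ ih).1 _
  have hsucc : ∀ w n, ncyl (p w (n + 1)) ⊆ ncyl (p w n) ∧ (p w n).1 < (p w (n + 1)).1 := by
    intro w n
    have hg := (hch _ _ (hmem w n)).2
    rw [hp]
    cases w n
    · exact ⟨hg.1, hg.2.2.1⟩
    · exact ⟨hg.2.1, hg.2.2.2.1⟩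
  have hanti : ∀ w, Antitone (fun n => ncyl (p w n)) := fun w =>
    antitone_nat_of_succ_le fun n => (hsucc w n).1
  have hlen : ∀ w n, n ≤ (p w n).1 := by
    intro w n
    induction n with
    | zero => exact Nat.zero_le _
    | succ n ih => have := (hsucc w n).2; omega
  have hne : ∀ w n, (ncyl (p w n)).Nonempty := by
    intro w n
    obtain ⟨x, hx⟩ := (seq n).2 ∅ IsGraphUnion.empty
    obtain ⟨b, hb, -⟩ := hx _ (hmem w n)
    exact ⟨b, hb⟩
  let β : (ℕ → Bool) → ℕ → ℕ := fun w i => (p w (i + 1)).2 ⟨i, hlen w (i + 1)⟩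
  have hβ : ∀ w n, β w ∈ ncyl (p w n) := by
    intro w n i
    obtain ⟨d, hd⟩ := hne w (max n (i + 1))
    have h1 := hanti w (le_max_left n (i.1 + 1)) hd
    have h2 := hanti w (le_max_right n (i.1 + 1)) hd
    rw [← h1 i]
    exact (h2 ⟨i, hlen w (i + 1)⟩).symm
  have hfst : ∀ w w', (φ (β w)).1 = (φ (β w')).1 := by
    intro w w'
    by_contra hne
    obtain ⟨U, U', hU, hU', hyU, hyU', hdis⟩ := t2_separation hne
    obtain ⟨m, hm⟩ := exists_ncyl_subset (hU.preimage (continuous_fst.comp hφ)) (b := β w) hyU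
    obtain ⟨m', hm'⟩ := exists_ncyl_subset (hU'.preimage (continuous_fst.comp hφ)) (b := β w') hyU'
    let N := max m m'
    obtain ⟨x, hx⟩ := (seq N).2 ∅ IsGraphUnion.empty
    obtain ⟨b, hb, hbx, -⟩ := hx _ (hmem w N)
    obtain ⟨b', hb', hbx', -⟩ := hx _ (hmem w' N)
    have h1 := hm N (le_max_left _ _) (ncyl_subset_nres (hβ w N) (hlen w N) hb)
    have h2 := hm' N (le_max_right _ _) (ncyl_subset_nres (hβ w' N) (hlen w' N) hb')
    simp only [Set.mem_preimage, Function.comp, hbx, hbx'] at h1 h2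
    exact Set.disjoint_left.1 hdis h1 h2
  have hinj : Function.Injective (fun w => (φ (β w)).2) := by
    intro w w' heq
    by_contra hne
    have hex : ∃ n, w n ≠ w' n := by
      by_contra! h
      exact hne (funext h)
    set n := Nat.find hex with hn
    have hagree : ∀ m ≤ n, p w m = p w' m := by
      intro m hm
      induction m with
      | zero => rfl
      | succ m ih =>
        rw [hp, hp, ih (by omega)]
        have : w m = w' m := by
          by_contra h
          have := Nat.find_min' hex h
          omega
        rw [this]
    have hd : w n ≠ w' n := Nat.find_spec hex
    have h1 := hβ w (n + 1)
    have h2 := hβ w' (n + 1)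
    rw [hp] at h1 h2
    rw [hagree n le_rfl] at h1
    have hg := (hch _ _ (hmem w' n)).2.2.2.2.2
    cases hw : w n <;> cases hw' : w' n
    · exact hd (hw.trans hw'.symm)
    · rw [hw] at h1; rw [hw'] at h2
      exact hg _ h1 _ h2 heq
    · rw [hw] at h1; rw [hw'] at h2
      exact hg _ h2 _ h1 heq.symm
    · exact hd (hw.trans hw'.symm)
  let w0 : ℕ → Bool := fun _ => false
  have hcnt : (Set.range (fun w => (φ (β w)).2)).Countable := by
    refine (hc (φ (β w0)).1).mono ?_
    rintro _ ⟨w, rfl⟩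
    refine ⟨β w, ?_⟩
    exact Prod.ext (hfst w w0) rfl
  have : Countable (ℕ → Bool) := by
    have := hcnt.to_subtype
    exact (Set.rangeFactorization_injective.2 hinj).countable
  obtain ⟨F, hF⟩ := exists_surjective_nat (ℕ → Bool)
  obtain ⟨m, hm⟩ := hF (fun n => !(F n n))
  have := congrFun hm m
  simp at this

end LN

theorem lusin_novikov_functions {X : Type*} [MeasurableSpace X] [StandardBorelSpace X]
    (E : X → X → Prop) (hE : Equivalence E)
    (hEBorel : MeasurableSet {p : X × X | E p.1 p.2})
    (hcount : ∀ x : X, {y | E x y}.Countable) :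
    ∃ f : ℕ → X → X, (∀ j, Measurable (f j)) ∧ (∀ j x, E x (f j x)) ∧
      ∀ x y, E x y → ∃ j, f j x = y := by
  rcases isEmpty_or_nonempty X with hX | ⟨⟨x0⟩⟩
  · exact ⟨fun _ => id, fun _ => measurable_id, fun _ x => hE.refl x, fun x => isEmptyElim x⟩
  let := upgradeStandardBorel X
  have hR : MeasureTheory.AnalyticSet {p : X × X | E p.1 p.2} := hEBorel.analyticSet
  rw [MeasureTheory.AnalyticSet] at hR
  rcases hR with hR | ⟨φ, hφ, hr⟩
  · have : (x0, x0) ∈ ({p : X × X | E p.1 p.2} : Set (X × X)) := hE.refl x0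
    rw [hR] at this
    exact absurd this (Set.notMem_empty _)
  obtain ⟨G, ⟨g, hgm, hgf, rfl⟩, hcov⟩ := lusin_novikov_cover hφ (by
    intro x
    rw [hr]
    exact hcount x)
  rw [hr] at hcov
  let P : ℕ → Set (X × X) := fun j => {p : X × X | E p.1 p.2} ∩ g j
  have hPm : ∀ j, MeasurableSet (P j) := fun j => hEBorel.inter (hgm j)
  have hPf : ∀ j x y y', (x, y) ∈ P j → (x, y') ∈ P j → y = y' := fun j x y y' h h' =>
    hgf j x y y' h.2 h'.2
  have hinj : ∀ j, Set.InjOn (Prod.fst : X × X → X) (P j) := by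
    rintro j ⟨x, y⟩ h ⟨x', y'⟩ h' heq
    simp only at heq
    subst heq
    rw [hPf j _ _ _ h h']
  have himg : ∀ j (V : Set (X × X)), MeasurableSet V → MeasurableSet (Prod.fst '' (P j ∩ V)) :=
    fun j V hV => ((hPm j).inter hV).image_of_measurable_injOn measurable_fst
      ((hinj j).mono Set.inter_subset_left)
  let f : ℕ → X → X := fun j x => if h : ∃ y, (x, y) ∈ P j then h.choose else x
  have hf1 : ∀ j x y, (x, y) ∈ P j → f j x = y := by
    intro j x y h
    have hex : ∃ y, (x, y) ∈ P j := ⟨y, h⟩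
    simp only [f, dif_pos hex]
    exact hPf j x _ _ hex.choose_spec h
  have hf2 : ∀ j x, (¬ ∃ y, (x, y) ∈ P j) → f j x = x := by
    intro j x h
    simp only [f, dif_neg h]
  refine ⟨f, ?_, ?_, ?_⟩
  · intro j V hV
    have : f j ⁻¹' V = (Prod.fst '' (P j ∩ Prod.snd ⁻¹' V)) ∪ ((Prod.fst '' (P j ∩ Set.univ))ᶜ ∩ V) := by
      ext x
      by_cases h : ∃ y, (x, y) ∈ P j
      · obtain ⟨y, hy⟩ := h
        rw [Set.mem_preimage, hf1 j x y hy]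
        constructor
        · intro hyV
          exact Or.inl ⟨(x, y), ⟨hy, hyV⟩, rfl⟩
        · rintro (⟨⟨x', y'⟩, ⟨h1, h2⟩, heq⟩ | h1)
          · simp only at heq
            subst heq
            rw [hPf j _ _ _ hy h1]
            exact h2
          · exact absurd ⟨(x, y), ⟨hy, trivial⟩, rfl⟩ h1.1
      · rw [Set.mem_preimage, hf2 j x h]
        constructor
        · intro hxV
          refine Or.inr ⟨?_, hxV⟩
          rintro ⟨⟨x', y'⟩, ⟨h1, -⟩, heq⟩
          simp only at heq
          subst heq
          exact h ⟨_, h1⟩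
        · rintro (⟨⟨x', y'⟩, ⟨h1, h2⟩, heq⟩ | h1)
          · simp only at heq
            subst heq
            exact absurd ⟨_, h1⟩ h
          · exact h1.2
    rw [this]
    exact (himg j _ (measurable_snd hV)).union ((himg j _ MeasurableSet.univ).compl.inter hV)
  · intro j x
    by_cases h : ∃ y, (x, y) ∈ P j
    · obtain ⟨y, hy⟩ := h
      rw [hf1 j x y hy]
      exact hy.1
    · rw [hf2 j x h]
      exact hE.refl x
  · intro x y hxy
    have : (x, y) ∈ ⋃ j, g j := hcov hxy
    obtain ⟨j, hj⟩ := Set.mem_iUnion.1 this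
    exact ⟨j, hf1 j x y ⟨hxy, hj⟩⟩

/-- If the weak Borel Ramsey property `E →*_B (E)^n_k` holds (for integers `n, k > 1`),
then the strong Borel Ramsey property `E →_B (E)^n_k` holds. -/
theorem weak_implies_strong_borel_ramsey {X : Type*} [MeasurableSpace X] [StandardBorelSpace X]
    (E : X → X → Prop) (hE : Equivalence E)
    (hEBorel : MeasurableSet {p : X × X | E p.1 p.2})
    (hcount : ∀ x : X, {y | E x y}.Countable)
    (haper : ∀ x : X, {y | E x y}.Infinite)
    (n k : ℕ) (hn : 1 < n) (hk : 1 < k)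
    (hweak : WeakBorelRamsey E n k) :
    StrongBorelRamsey E n k := by
  intro c hc
  obtain ⟨Y, hYm, hYc, hYmono⟩ := hweak c hc
  obtain ⟨f, hfm, hfE, hfs⟩ := lusin_novikov_functions E hE hEBorel hcount
  obtain ⟨e, he⟩ := MeasureTheory.exists_measurableEmbedding_real X
  have heq : ∀ i j, MeasurableSet {x | f i x = f j x} := fun i j =>
    measurableSet_eq_fun (hfm i) (hfm j)
  -- the part where `Y` is finite
  let F : Set X := {x | {y | y ∈ Y ∧ E x y}.Finite}
  have hFinv : ∀ x y, E x y → x ∈ F → y ∈ F := by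
    intro x y hxy hx
    refine Set.Finite.subset hx ?_
    rintro y' ⟨h1, h2⟩
    exact ⟨h1, hE.trans hxy h2⟩
  have hFm : MeasurableSet F := by
    have : F = ⋃ N : ℕ, ⋂ j : ℕ, ((f j ⁻¹' Y)ᶜ ∪ ⋃ i : ℕ, ⋃ _ : i < N, {x | f j x = f i x}) := by
      ext x
      simp only [Set.mem_iUnion, Set.mem_iInter, Set.mem_union, Set.mem_compl_iff, Set.mem_preimage,
        Set.mem_ofPred_eq, exists_prop]
      constructor
      · intro hx
        have hx' : {y | y ∈ Y ∧ E x y}.Finite := hx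
        have h1 : ∀ y, ∃ j, E x y → f j x = y := by
          intro y
          by_cases h : E x y
          · obtain ⟨j, hj⟩ := hfs x y h
            exact ⟨j, fun _ => hj⟩
          · exact ⟨0, fun h' => absurd h' h⟩
        choose idx hidx using h1
        obtain ⟨N, hN⟩ := (hx'.image idx).bddAbove
        refine ⟨N + 1, fun j => ?_⟩
        by_cases hj : f j x ∈ Y
        · right
          refine ⟨idx (f j x), Nat.lt_succ_of_le (hN ⟨f j x, ⟨hj, hfE j x⟩, rfl⟩), ?_⟩
          exact (hidx _ (hfE j x)).symm
        · exact Or.inl hj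
      · rintro ⟨N, hN⟩
        show {y | y ∈ Y ∧ E x y}.Finite
        refine ((Finset.range N).finite_toSet.image (fun i => f i x)).subset ?_
        rintro y ⟨hy, hxy⟩
        obtain ⟨j, rfl⟩ := hfs x y hxy
        rcases hN j with h | ⟨i, hi, h⟩
        · exact absurd hy h
        · exact ⟨i, by simpa using hi, h.symm⟩
    rw [this]
    refine MeasurableSet.iUnion fun N => MeasurableSet.iInter fun j => ?_
    refine (hfm j hYm).compl.union ?_
    exact MeasurableSet.iUnion fun i => MeasurableSet.iUnion fun _ => heq j i
  -- representatives
  obtain ⟨t, htm, ht⟩ := exists_measurable_choice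
    (fun (x : X) (j : ℕ) => x ∈ F → (f j x ∈ Y ∧ ∀ i, f i x ∈ Y → e (f j x) ≤ e (f i x)))
    (by
      intro x
      by_cases hx : x ∈ F
      · have hx' : {y | y ∈ Y ∧ E x y}.Finite := hx
        obtain ⟨y, hy, hxy⟩ := hYc x
        obtain ⟨m, ⟨hm1, hm2⟩, hm⟩ := Set.exists_min_image _ e hx' ⟨y, hy, hxy⟩
        obtain ⟨j, rfl⟩ := hfs x m hm2
        exact ⟨j, fun _ => ⟨hm1, fun i hi => hm _ ⟨hi, hfE i x⟩⟩⟩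
      · exact ⟨0, fun h => absurd h hx⟩)
    (by
      intro j
      have : {x | x ∈ F → (f j x ∈ Y ∧ ∀ i, f i x ∈ Y → e (f j x) ≤ e (f i x))}
          = Fᶜ ∪ ((f j ⁻¹' Y) ∩ ⋂ i : ℕ, ((f i ⁻¹' Y)ᶜ ∪ {x | e (f j x) ≤ e (f i x)})) := by
        ext x
        simp only [Set.mem_iInter, Set.mem_union, Set.mem_compl_iff, Set.mem_preimage,
          Set.mem_ofPred_eq, Set.mem_inter_iff, imp_iff_not_or]
      rw [this]
      refine hFm.compl.union ((hfm j hYm).inter (MeasurableSet.iInter fun i => ?_))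
      exact (hfm i hYm).compl.union
        (measurableSet_le (he.measurable.comp (hfm j)) (he.measurable.comp (hfm i))))
  let r : X → X := fun x => f (t x) x
  have hrm : Measurable r := by
    intro V hV
    have : r ⁻¹' V = ⋃ j : ℕ, (t ⁻¹' {j} ∩ f j ⁻¹' V) := by
      ext x
      simp [r]
    rw [this]
    exact MeasurableSet.iUnion fun j => (htm (measurableSet_singleton j)).inter (hfm j hV)
  have hrE : ∀ x, E x (r x) := fun x => hfE _ x
  have hrinv : ∀ x y, E x y → x ∈ F → r x = r y := by
    have hle : ∀ x y, E x y → x ∈ F → e (r x) ≤ e (r y) := by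
      intro x y hxy hx
      have h1 := ht x hx
      have h2 := ht y (hFinv x y hxy hx)
      obtain ⟨i, hi⟩ := hfs x (r y) (hE.trans hxy (hrE y))
      have := h1.2 i (by rw [hi]; exact h2.1)
      rw [hi] at this
      exact this
    intro x y hxy hx
    exact he.injective (le_antisymm (hle x y hxy hx) (hle y x (hE.symm hxy) (hFinv x y hxy hx)))
  -- Ramsey in every class, measurably
  let H0 : X → Set ℕ := fun z => {i | ∀ i' < i, f i' z ≠ f i z}
  have hH0inj : ∀ z, Set.InjOn (fun i => f i z) (H0 z) := by
    intro z i hi j hj hij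
    rcases lt_trichotomy i j with h | h | h
    · exact absurd hij (hj i h)
    · exact h
    · exact absurd hij.symm (hi j h)
  have hH0m : ∀ b, MeasurableSet {z | b ∈ H0 z} := by
    intro b
    have : {z | b ∈ H0 z} = ⋂ i : ℕ, ⋂ _ : i < b, {z | f i z = f b z}ᶜ := by
      ext z
      simp [H0]
    rw [this]
    exact MeasurableSet.iInter fun i => MeasurableSet.iInter fun _ => (heq i b).compl
  have hH0i : ∀ z, (H0 z).Infinite := by
    intro z hfin
    refine haper z ((hfin.image (fun i => f i z)).subset ?_)
    intro y hy
    have hex := hfs z y hy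
    refine ⟨Nat.find hex, fun i' hi' h => ?_, Nat.find_spec hex⟩
    exact Nat.find_min hex hi' (h.trans (Nat.find_spec hex))
  let c' : Finset ℕ → X → Fin k := fun A z =>
    if A.card = n then c (A.image (fun i => f i z)) else c ∅
  have hc' : ∀ A, Measurable (c' A) := by
    intro A
    by_cases hA : A.card = n
    · have h1 : c' A = (fun v : Fin n → X => c (Set.finite_range v).toFinset) ∘
          (fun z => fun i : Fin n => f (A.orderEmbOfFin hA i) z) := by
        funext z
        simp only [c', if_pos hA, Function.comp]
        congr 1
        ext y
        simp only [Finset.mem_image, Set.Finite.mem_toFinset, Set.mem_range]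
        constructor
        · rintro ⟨i, hi, rfl⟩
          have : i ∈ Set.range (A.orderEmbOfFin hA) := by
            rw [Finset.range_orderEmbOfFin]; exact hi
          obtain ⟨l, rfl⟩ := this
          exact ⟨l, rfl⟩
        · rintro ⟨l, rfl⟩
          exact ⟨_, Finset.orderEmbOfFin_mem A hA l, rfl⟩
      rw [h1]
      exact hc.comp (measurable_pi_lambda _ fun i => hfm _)
    · have h1 : c' A = fun _ => c ∅ := by
        funext z
        simp only [c', if_neg hA]
      rw [h1]
      exact measurable_const
  obtain ⟨H, hHm, hHi, hHs, hHmono⟩ := ramsey_measurable n c' hc' H0 hH0m hH0i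
  have hHinj : ∀ z, Set.InjOn (fun i => f i z) (H z) := fun z => (hH0inj z).mono (hHs z)
  let Y2 : Set X := {x | ∃ i, i ∈ H (r x) ∧ f i (r x) = x}
  have hY2m : MeasurableSet Y2 := by
    have : Y2 = ⋃ i : ℕ, (r ⁻¹' {z | i ∈ H z} ∩ {x | f i (r x) = x}) := by
      ext x
      simp [Y2]
    rw [this]
    exact MeasurableSet.iUnion fun i => (hrm (hHm i)).inter
      (measurableSet_eq_fun ((hfm i).comp hrm) measurable_id)
  refine ⟨(Y ∩ Fᶜ) ∪ (F ∩ Y2), (hYm.inter hFm.compl).union (hFm.inter hY2m), ?_, ?_⟩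
  · intro x
    by_cases hx : x ∈ F
    · have hinf : ((fun i => f i (r x)) '' H (r x)).Infinite := (hHi _).image (hHinj _)
      refine hinf.mono ?_
      rintro _ ⟨i, hi, rfl⟩
      have hE1 : E x (f i (r x)) := hE.trans (hrE x) (hfE i _)
      refine ⟨Or.inr ⟨hFinv _ _ hE1 hx, i, ?_⟩, hE1⟩
      rw [← hrinv _ _ hE1 hx]
      exact ⟨hi, rfl⟩
    · have hx' : {y | y ∈ Y ∧ E x y}.Infinite := hx
      refine hx'.mono ?_
      rintro y ⟨hy, hxy⟩
      exact ⟨Or.inl ⟨hy, fun h => hx (hFinv _ _ (hE.symm hxy) h)⟩, hxy⟩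
  · intro x
    by_cases hx : x ∈ F
    · obtain ⟨a, ha⟩ := hHmono (r x)
      refine ⟨a, fun A hA hAY hAE => ?_⟩
      have hsub : (A : Set X) ⊆ (fun i => f i (r x)) '' H (r x) := by
        intro y hy
        have hxy := hAE y hy
        rcases hAY hy with h | ⟨-, i, hi, hi2⟩
        · exact absurd (hFinv _ _ hxy hx) h.2
        · rw [← hrinv _ _ hxy hx] at hi hi2
          exact ⟨i, hi, hi2⟩
      obtain ⟨B, hB, rfl⟩ := Finset.subset_set_image_iff.1 hsub
      have hcard : B.card = n := by
        rw [← hA, Finset.card_image_of_injOn ((hHinj _).mono hB)]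
      have := ha B hcard hB
      simp only [c', if_pos hcard] at this
      convert this
    · obtain ⟨a, ha⟩ := hYmono x
      refine ⟨a, fun A hA hAY hAE => ha A hA (fun y hy => ?_) hAE⟩
      rcases hAY hy with h | h
      · exact h.1
      · exact absurd (hFinv _ _ (hE.symm (hAE y hy)) h.1) hx
end
end

section
/- Let X be a standard Borel space and let E be an aperiodic, countable Borel equivalence relation on X. If E is smooth, then for all integers n, k > 1 the strong Borel Ramsey property E →_B (E)^n_k holds. -/
open Classical

noncomputable section

namespace SBR
open Set Filter Topology

/-- `A` is covered by countably many Borel sets on which `f` is injective. -/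
def ISmall {X Z : Type*} [MeasurableSpace X] (f : X → Z) (A : Set X) : Prop :=
  ∃ T : Set (Set X), T.Countable ∧ (∀ t ∈ T, MeasurableSet t ∧ InjOn f t) ∧ A ⊆ ⋃₀ T

theorem ISmall.mono {X Z : Type*} [MeasurableSpace X] {f : X → Z} {A B : Set X}
    (h : ISmall f B) (hAB : A ⊆ B) : ISmall f A := by
  obtain ⟨T, h1, h2, h3⟩ := h
  exact ⟨T, h1, h2, hAB.trans h3⟩

theorem ISmall.iUnion {X Z ι : Type*} [Countable ι] [MeasurableSpace X] {f : X → Z}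
    {A : ι → Set X} (h : ∀ i, ISmall f (A i)) : ISmall f (⋃ i, A i) := by
  choose T h1 h2 h3 using h
  refine ⟨⋃ i, T i, countable_iUnion h1, ?_, ?_⟩
  · intro t ht
    obtain ⟨i, hi⟩ := mem_iUnion.1 ht
    exact h2 i t hi
  · intro x hx
    obtain ⟨i, hi⟩ := mem_iUnion.1 hx
    obtain ⟨t, ht, hxt⟩ := h3 i hi
    exact ⟨t, mem_iUnion.2 ⟨i, ht⟩, hxt⟩

theorem ISmall.union {X Z : Type*} [MeasurableSpace X] {f : X → Z}
    {A B : Set X} (h : ISmall f A) (h' : ISmall f B) : ISmall f (A ∪ B) := by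
  rw [union_eq_iUnion]
  apply ISmall.iUnion
  rintro (_ | _)
  · exact h'
  · exact h

theorem ISmall.of_injOn {X Z : Type*} [MeasurableSpace X] {f : X → Z}
    {A : Set X} (h : MeasurableSet A) (h' : InjOn f A) : ISmall f A :=
  ⟨{A}, countable_singleton A, by simp [h, h'], by simp⟩

/-- Smallness of tuples of sets. -/
def TSmall {X Z κ : Type*} [MeasurableSpace X] [MeasurableSpace Z] (f : X → Z)
    (A : κ → Set X) : Prop :=
  ∃ B : κ → Set Z, (∀ k, MeasurableSet (B k)) ∧ (∀ z, ∃ k, z ∉ B k) ∧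
    ∀ k, ISmall f (A k ∩ f ⁻¹' (B k)ᶜ)

theorem tsmall_split {X Z κ : Type*} [MeasurableSpace X] [MeasurableSpace Z] [Countable κ]
    [DecidableEq κ]
    {f : X → Z} (hf : Measurable f) (A : κ → Set X) (a b : κ) (hab : a ≠ b) (O : Set X)
    (ha : A a = O) (hb : A b = O) (hO : MeasurableSet O)
    (P : Set (Set X)) (hP : P.Countable) (hPm : ∀ U ∈ P, MeasurableSet U)
    (hsep : ∀ x ∈ O, ∀ y ∈ O, x ≠ y → ∃ U ∈ P, ∃ V ∈ P, x ∈ U ∧ y ∈ V ∧ Disjoint U V)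
    (hs : ∀ U ∈ P, ∀ V ∈ P, Disjoint U V →
      TSmall f (Function.update (Function.update A a U) b V)) : TSmall f A := by
  let I := {p : P × P // Disjoint p.1.1 p.2.1}
  have : Countable P := hP.to_subtype
  have hs' : ∀ p : I, TSmall f (Function.update (Function.update A a p.1.1.1) b p.1.2.1) :=
    fun p => hs _ p.1.1.2 _ p.1.2.2 p.2
  choose B hB1 hB2 hB3 using hs'
  have hBa : ∀ p : I, ISmall f (p.1.1.1 ∩ f ⁻¹' (B p a)ᶜ) := by
    intro p
    have := hB3 p a
    rwa [Function.update_of_ne hab, Function.update_self] at this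
  have hBb : ∀ p : I, ISmall f (p.1.2.1 ∩ f ⁻¹' (B p b)ᶜ) := by
    intro p
    have := hB3 p b
    rwa [Function.update_self] at this
  have hBk : ∀ k, k ≠ a → k ≠ b → ∀ p : I, ISmall f (A k ∩ f ⁻¹' (B p k)ᶜ) := by
    intro k h1 h2 p
    have := hB3 p k
    rwa [Function.update_of_ne h2, Function.update_of_ne h1] at this
  let K : Set Z := ⋂ k : {k // k ≠ a ∧ k ≠ b}, ⋂ p : I, B p k
  have hK : MeasurableSet K := MeasurableSet.iInter fun k => MeasurableSet.iInter fun p => hB1 _ _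
  let C : κ → Set Z := fun k => if k = a then Kᶜ else if k = b then univ else ⋂ p : I, B p k
  have hCa : C a = Kᶜ := by simp [C]
  have hCb : C b = univ := by simp [C, hab.symm]
  have hCk : ∀ k, k ≠ a → k ≠ b → C k = ⋂ p : I, B p k := by
    intro k h1 h2; simp [C, h1, h2]
  refine ⟨C, ?_, ?_, ?_⟩
  · intro k
    by_cases h1 : k = a
    · subst h1; rw [hCa]; exact hK.compl
    by_cases h2 : k = b
    · subst h2; rw [hCb]; exact MeasurableSet.univ
    rw [hCk k h1 h2]
    exact MeasurableSet.iInter fun p => hB1 _ _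
  · intro z
    by_contra! hz
    have h1 := hz a
    rw [hCa] at h1
    apply h1
    refine mem_iInter.2 fun k => ?_
    have := hz k
    rwa [hCk k k.2.1 k.2.2] at this
  · intro k
    by_cases h1 : k = a
    · subst h1
      rw [hCa, ha, compl_compl]
      let Q : Set X := (⋃ p : I, (p.1.1.1 ∩ f ⁻¹' (B p k)ᶜ)) ∪ (⋃ p : I, (p.1.2.1 ∩ f ⁻¹' (B p b)ᶜ))
      have hQ : ISmall f Q := (ISmall.iUnion hBa).union (ISmall.iUnion hBb)
      have hQm : MeasurableSet Q := by
        refine (MeasurableSet.iUnion fun p => ?_).union (MeasurableSet.iUnion fun p => ?_)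
        · exact (hPm _ p.1.1.2).inter (hf (hB1 _ _).compl)
        · exact (hPm _ p.1.2.2).inter (hf (hB1 _ _).compl)
      have hR : ISmall f ((O ∩ f ⁻¹' K) \ Q) := by
        apply ISmall.of_injOn ((hO.inter (hf hK)).diff hQm)
        rintro x ⟨⟨hx1, hx2⟩, hx3⟩ y ⟨⟨hy1, hy2⟩, hy3⟩ hxy
        by_contra hne
        obtain ⟨U, hU, V, hV, hxU, hyV, hd⟩ := hsep x hx1 y hy1 hne
        let p : I := ⟨(⟨U, hU⟩, ⟨V, hV⟩), hd⟩
        obtain ⟨j, hj⟩ := hB2 p (f x)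
        apply hj
        by_cases j1 : j = k
        · subst j1
          by_contra hc
          exact hx3 (Or.inl (mem_iUnion.2 ⟨p, hxU, hc⟩))
        by_cases j2 : j = b
        · subst j2
          by_contra hc
          rw [hxy] at hc
          exact hy3 (Or.inr (mem_iUnion.2 ⟨p, hyV, hc⟩))
        exact mem_iInter.1 (mem_iInter.1 hx2 ⟨j, j1, j2⟩) p
      refine (hR.union hQ).mono ?_
      intro x hx
      by_cases h : x ∈ Q
      · exact Or.inr h
      · exact Or.inl ⟨hx, h⟩
    by_cases h2 : k = b
    · subst h2
      rw [hCb]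
      exact ISmall.of_injOn (by simp) (by simp)
    · rw [hCk k h1 h2]
      refine (ISmall.iUnion (hBk k h1 h2)).mono ?_
      rintro x ⟨hx, hx'⟩
      simp only [mem_preimage, mem_compl_iff, mem_iInter, not_forall] at hx'
      obtain ⟨p, hp⟩ := hx'
      exact mem_iUnion.2 ⟨p, hx, hp⟩

/-- Good refinements of `O`. -/
def Good {X Z : Type*} [MetricSpace X] [MetricSpace Z] (f : X → Z) (O : Set X) (ε : ℝ)
    (U : Set X) : Prop :=
  IsOpen U ∧ closure U ⊆ O ∧ (∀ x ∈ U, ∀ y ∈ U, dist x y ≤ ε) ∧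
    (∀ x ∈ U, ∀ y ∈ U, dist (f x) (f y) ≤ ε)

theorem exists_good {X Z : Type*} [MetricSpace X] [SecondCountableTopology X]
    [MetricSpace Z] {f : X → Z} (hf : Continuous f) {O : Set X} (hO : IsOpen O) {ε : ℝ}
    (hε : 0 < ε) {x : X} (hx : x ∈ O) {δ : ℝ} (hδ : 0 < δ) :
    ∃ U ∈ TopologicalSpace.countableBasis X, Good f O ε U ∧ x ∈ U ∧ U ⊆ Metric.ball x δ := by
  obtain ⟨r1, hr1, h1⟩ := Metric.isOpen_iff.1 hO x hx
  obtain ⟨r2, hr2, h2⟩ := Metric.continuous_iff.1 hf x (ε / 2) (by positivity)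
  let r := min (min (r1 / 2) r2) (min (ε / 2) δ)
  have hr : 0 < r := by simp only [r, lt_min_iff]; exact ⟨⟨by positivity, hr2⟩, by positivity, hδ⟩
  have e1 : r ≤ r1 / 2 := (min_le_left _ _).trans (min_le_left _ _)
  have e2 : r ≤ r2 := (min_le_left _ _).trans (min_le_right _ _)
  have e3 : r ≤ ε / 2 := (min_le_right _ _).trans (min_le_left _ _)
  have e4 : r ≤ δ := (min_le_right _ _).trans (min_le_right _ _)
  obtain ⟨U, hU, hxU, hUr⟩ := (TopologicalSpace.isBasis_countableBasis X).exists_subset_of_mem_open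
    (Metric.mem_ball_self hr) (Metric.isOpen_ball (x := x) (ε := r))
  refine ⟨U, hU, ⟨(TopologicalSpace.isBasis_countableBasis X).isOpen hU, ?_, ?_, ?_⟩, hxU,
    hUr.trans (Metric.ball_subset_ball e4)⟩
  · refine (closure_mono hUr).trans (Metric.closure_ball_subset_closedBall.trans ?_)
    refine (Metric.closedBall_subset_ball ?_).trans h1
    linarith
  · intro y hy z hz
    have a1 := Metric.mem_ball.1 (hUr hy)
    have a2 := Metric.mem_ball.1 (hUr hz)
    have := dist_triangle_right y z x
    linarith
  · intro y hy z hz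
    have a1 := h2 y ((Metric.mem_ball.1 (hUr hy)).trans_le e2)
    have a2 := h2 z ((Metric.mem_ball.1 (hUr hz)).trans_le e2)
    have := dist_triangle_right (f y) (f z) (f x)
    linarith

theorem level_step {X Z ι : Type*} [MetricSpace X] [SecondCountableTopology X]
    [MeasurableSpace X] [BorelSpace X]
    [MetricSpace Z] [MeasurableSpace Z] [BorelSpace Z] {f : X → Z} (hf : Continuous f)
    [Finite ι] (A : ι → Set X) (hA : ∀ i, IsOpen (A i)) (hbig : ¬ TSmall f A) {ε : ℝ}
    (hε : 0 < ε) :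
    ∃ A' : ι × Bool → Set X, ¬ TSmall f A' ∧ (∀ p, Good f (A p.1) ε (A' p)) ∧
      ∀ i, Disjoint (A' (i, false)) (A' (i, true)) := by
  have : Fintype ι := Fintype.ofFinite ι
  have key : ∀ T : Finset ι, ∃ A' : ι × Bool → Set X, ¬ TSmall f A' ∧
      (∀ i ∉ T, ∀ b, A' (i, b) = A i) ∧
      (∀ i ∈ T, (∀ b, Good f (A i) ε (A' (i, b))) ∧ Disjoint (A' (i, false)) (A' (i, true))) := by
    intro T
    induction T using Finset.induction_on with
    | empty =>
      refine ⟨fun p => A p.1, ?_, by simp, by simp⟩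
      rintro ⟨B, hB1, hB2, hB3⟩
      apply hbig
      refine ⟨fun i => B (i, false) ∩ B (i, true), fun i => (hB1 _).inter (hB1 _), ?_, ?_⟩
      · intro z
        obtain ⟨⟨i, b⟩, h⟩ := hB2 z
        refine ⟨i, ?_⟩
        rintro ⟨h1, h2⟩
        cases b
        · exact h h1
        · exact h h2
      · intro i
        refine ((hB3 (i, false)).union (hB3 (i, true))).mono ?_
        rintro x ⟨h1, h2⟩
        by_cases h : f x ∈ B (i, false)
        · exact Or.inr ⟨h1, fun h' => h2 ⟨h, h'⟩⟩
        · exact Or.inl ⟨h1, h⟩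
    | insert i T hi ih =>
      obtain ⟨A', h1, h2, h3⟩ := ih
      by_contra hcon
      apply h1
      refine tsmall_split hf.measurable A' (i, false) (i, true) (by simp) (A i) (h2 i hi _)
        (h2 i hi _) (hA i).measurableSet {U ∈ TopologicalSpace.countableBasis X | Good f (A i) ε U}
        ((TopologicalSpace.countable_countableBasis X).mono (sep_subset _ _))
        (fun U hU => hU.2.1.measurableSet) ?_ ?_
      · intro x hx y hy hne
        have hd : 0 < dist x y / 2 := by have := dist_pos.2 hne; positivity
        obtain ⟨U, hU1, hU2, hU3, hU4⟩ := exists_good hf (hA i) hε hx hd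
        obtain ⟨V, hV1, hV2, hV3, hV4⟩ := exists_good hf (hA i) hε hy hd
        refine ⟨U, ⟨hU1, hU2⟩, V, ⟨hV1, hV2⟩, hU3, hV3, ?_⟩
        exact (Metric.ball_disjoint_ball (by linarith)).mono hU4 hV4
      · intro U hU V hV hd
        by_contra hb
        apply hcon
        refine ⟨_, hb, ?_, ?_⟩
        · intro j hj b
          rw [Finset.mem_insert, not_or] at hj
          rw [Function.update_of_ne (by simp [hj.1]), Function.update_of_ne (by simp [hj.1])]
          exact h2 j hj.2 b
        · intro j hj
          by_cases hji : j = i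
          · subst hji
            refine ⟨?_, ?_⟩
            · rintro (_ | _)
              · simpa using hU.2
              · simpa using hV.2
            · simpa using hd
          · have hjT : j ∈ T := (Finset.mem_insert.1 hj).resolve_left hji
            have e : ∀ b, Function.update (Function.update A' (i, false) U) (i, true) V (j, b)
                = A' (j, b) := by
              intro b
              rw [Function.update_of_ne (by simp [hji]), Function.update_of_ne (by simp [hji])]
            simp only [e]
            exact h3 j hjT
  obtain ⟨A', h1, -, h3⟩ := key Finset.univ
  exact ⟨A', h1, fun p => (h3 p.1 (Finset.mem_univ _)).1 p.2, fun i => (h3 i (Finset.mem_univ _)).2⟩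

theorem big_nonempty {X Z κ : Type*} [MeasurableSpace X] [MeasurableSpace Z] {f : X → Z}
    {A : κ → Set X} (h : ¬ TSmall f A) (k : κ) : (A k).Nonempty := by
  by_contra hc
  rw [not_nonempty_iff_eq_empty] at hc
  apply h
  refine ⟨fun j => if j = k then ∅ else univ, ?_, fun z => ⟨k, by simp⟩, ?_⟩
  · intro j; dsimp only; split_ifs <;> simp
  · intro j
    by_cases hj : j = k
    · subst hj; rw [hc]; exact ISmall.of_injOn (by simp) (by simp)
    · simp only [hj, if_false]; exact ISmall.of_injOn (by simp) (by simp)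

theorem big_dist {X Z κ : Type*} [MeasurableSpace X] [MetricSpace Z] [MeasurableSpace Z]
    [BorelSpace Z] {f : X → Z}
    {A : κ → Set X} (h : ¬ TSmall f A) {ε : ℝ} (hε : 0 ≤ ε)
    (hd : ∀ k, ∀ x ∈ A k, ∀ y ∈ A k, dist (f x) (f y) ≤ ε)
    {j k : κ} {x y : X} (hx : x ∈ A j) (hy : y ∈ A k) : dist (f x) (f y) ≤ 2 * ε := by
  by_cases hjk : j = k
  · subst hjk
    have := hd j x hx y hy
    linarith
  by_contra! hc
  apply h
  refine ⟨fun i => if i = j then Metric.closedBall (f x) ε else if i = k then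
    Metric.closedBall (f y) ε else univ, ?_, ?_, ?_⟩
  · intro i
    dsimp only
    split_ifs
    · exact Metric.isClosed_closedBall.measurableSet
    · exact Metric.isClosed_closedBall.measurableSet
    · exact MeasurableSet.univ
  · intro z
    by_contra! hz
    have h1 := hz j
    have h2 := hz k
    simp only [if_true, Ne.symm hjk, if_false, Metric.mem_closedBall] at h1 h2
    have := dist_triangle_left (f x) (f y) z
    linarith
  · intro i
    have : A i ∩ f ⁻¹' (if i = j then Metric.closedBall (f x) ε else if i = k then
        Metric.closedBall (f y) ε else univ)ᶜ = ∅ := by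
      rw [eq_empty_iff_forall_notMem]
      rintro u ⟨hu1, hu2⟩
      apply hu2
      split_ifs with e1 e2
      · subst e1; exact hd _ _ hu1 _ hx
      · subst e2; exact hd _ _ hu1 _ hy
      · trivial
    rw [this]
    exact ISmall.of_injOn (by simp) (by simp)

theorem lusin_novikov {X Z : Type*} [MetricSpace X] [CompleteSpace X] [SecondCountableTopology X]
    [MeasurableSpace X] [BorelSpace X]
    [MetricSpace Z] [MeasurableSpace Z] [BorelSpace Z] {f : X → Z} (hf : Continuous f)
    (hc : ∀ z, (f ⁻¹' {z}).Countable) : ISmall f univ := by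
  by_contra hbig
  -- levels
  let St : ℕ → Type _ := fun n => {A : (Fin n → Bool) → Set X // (∀ s, IsOpen (A s)) ∧ ¬ TSmall f A}
  have step : ∀ n (A : St n), ∃ A' : St (n + 1),
      (∀ s : Fin (n + 1) → Bool, Good f (A.1 (Fin.init s)) (1 / ((n : ℝ) + 1)) (A'.1 s)) ∧
      ∀ s t : Fin (n + 1) → Bool, Fin.init s = Fin.init t → s (Fin.last n) ≠ t (Fin.last n) →
        Disjoint (A'.1 s) (A'.1 t) := by
    intro n A
    obtain ⟨A', h1, h2, h3⟩ := level_step hf A.1 A.2.1 A.2.2 (ε := 1 / ((n : ℝ) + 1))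
      (by positivity)
    have hg : ∀ s : Fin (n + 1) → Bool, Good f (A.1 (Fin.init s)) (1 / ((n : ℝ) + 1))
      (A' (Fin.init s, s (Fin.last n))) := fun s => h2 (Fin.init s, s (Fin.last n))
    refine ⟨⟨fun s => A' (Fin.init s, s (Fin.last n)), fun s => (hg s).1, ?_⟩, hg, ?_⟩
    · rintro ⟨B, hB1, hB2, hB3⟩
      apply h1
      refine ⟨fun p => B (Fin.snoc (α := fun _ => Bool) p.1 p.2), fun p => hB1 _, ?_, ?_⟩
      · intro z
        obtain ⟨s, hs⟩ := hB2 z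
        refine ⟨(Fin.init s, s (Fin.last n)), ?_⟩
        simpa using hs
      · intro p
        have := hB3 (Fin.snoc (α := fun _ => Bool) p.1 p.2)
        simpa using this
    · intro s t hst hne
      dsimp only
      rw [hst]
      generalize Fin.init t = u
      have := h3 u
      cases hs : s (Fin.last n) <;> cases ht : t (Fin.last n)
      · simp [hs, ht] at hne
      · exact this
      · exact this.symm
      · simp [hs, ht] at hne
  choose nxt hn1 hn2 using step
  have h0 : ¬ TSmall f (fun _ : Fin 0 → Bool => (univ : Set X)) := by
    rintro ⟨B, hB1, hB2, hB3⟩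
    apply hbig
    have e := hB3 default
    refine e.mono ?_
    intro x _
    refine ⟨trivial, ?_⟩
    obtain ⟨k, hk⟩ := hB2 (f x)
    rw [Subsingleton.elim k default] at hk
    exact hk
  let A : ∀ n, St n := fun n => Nat.rec ⟨fun _ => univ, fun _ => isOpen_univ, h0⟩ nxt n
  have hA1 : ∀ n (s : Fin (n + 1) → Bool),
      Good f ((A n).1 (Fin.init s)) (1 / ((n : ℝ) + 1)) ((A (n + 1)).1 s) := fun n => hn1 n (A n)
  have hA2 : ∀ n (s t : Fin (n + 1) → Bool), Fin.init s = Fin.init t →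
      s (Fin.last n) ≠ t (Fin.last n) →
        Disjoint ((A (n + 1)).1 s) ((A (n + 1)).1 t) := fun n => hn2 n (A n)
  let r : (ℕ → Bool) → ∀ n, Fin n → Bool := fun α n i => α i
  have hr : ∀ α n, Fin.init (r α (n + 1)) = r α n := fun α n => rfl
  let D : (ℕ → Bool) → ℕ → Set X := fun α n => (A n).1 (r α n)
  have hD : ∀ α n, Good f (D α n) (1 / ((n : ℝ) + 1)) (D α (n + 1)) := fun α n => hA1 n (r α (n + 1))
  have hanti : ∀ α, Antitone (D α) := fun α =>
    antitone_nat_of_succ_le fun n => subset_closure.trans (hD α n).2.1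
  have hne : ∀ α n, (D α n).Nonempty := fun α n => big_nonempty (A n).2.2 _
  choose p hp using hne
  have hlim : ∀ α, ∃ x, ∀ n, x ∈ D α n := by
    intro α
    have hcs : CauchySeq (fun n => p α (n + 1)) := by
      refine cauchySeq_of_le_tendsto_0 (fun n : ℕ => 1 / ((n : ℝ) + 1)) ?_
        tendsto_one_div_add_atTop_nhds_zero_nat
      intro m k N hm hk
      exact (hD α N).2.2.1 _ (hanti α (Nat.succ_le_succ hm) (hp α (m + 1))) _
        (hanti α (Nat.succ_le_succ hk) (hp α (k + 1)))
    obtain ⟨x, hx⟩ := cauchySeq_tendsto_of_complete hcs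
    refine ⟨x, fun n => (hD α n).2.1 ?_⟩
    refine mem_closure_of_tendsto hx ?_
    filter_upwards [eventually_ge_atTop n] with m hm
    exact hanti α (Nat.succ_le_succ hm) (hp α (m + 1))
  choose x hx using hlim
  have hfx : ∀ α β, f (x α) = f (x β) := by
    intro α β
    have hle : ∀ n : ℕ, dist (f (x α)) (f (x β)) ≤ 2 * (1 / ((n : ℝ) + 1)) := by
      intro n
      exact big_dist (A (n + 1)).2.2 (by positivity) (fun s => (hA1 n s).2.2.2)
        (hx α (n + 1)) (hx β (n + 1))
    have ht : Tendsto (fun n : ℕ => 2 * (1 / ((n : ℝ) + 1))) atTop (𝓝 (2 * 0)) :=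
      tendsto_one_div_add_atTop_nhds_zero_nat.const_mul 2
    have := ge_of_tendsto' ht hle
    rw [mul_zero] at this
    exact dist_le_zero.1 this
  have hinj : Function.Injective x := by
    intro α β hαβ
    by_contra hne
    have hex : ∃ n, α n ≠ β n := Function.ne_iff.1 hne
    have hmin : ∀ m < Nat.find hex, α m = β m := fun m hm => not_not.1 (Nat.find_min hex hm)
    have hdis := hA2 (Nat.find hex) (r α _) (r β _) (by
      funext i
      exact hmin i i.2) (Nat.find_spec hex)
    have hxb := hx β (Nat.find hex + 1)
    rw [← hαβ] at hxb
    exact Set.disjoint_left.1 hdis (hx α (Nat.find hex + 1)) hxb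
  have hcount := hc (f (x fun _ => false))
  have hsub : range x ⊆ f ⁻¹' {f (x fun _ => false)} := by
    rintro _ ⟨α, rfl⟩
    exact hfx _ _
  have h3 : (range x).Countable := hcount.mono hsub
  have h6 : Cardinal.mk (ℕ → Bool) = Cardinal.continuum := by simp
  have h4 : Countable (ℕ → Bool) := by
    have := h3.to_subtype
    exact (Set.rangeFactorization_injective.2 hinj).countable
  have h5 : Cardinal.mk (ℕ → Bool) ≤ Cardinal.aleph0 := Cardinal.mk_le_aleph0_iff.2 h4
  rw [h6] at h5
  exact absurd h5 (not_le.2 Cardinal.aleph0_lt_continuum)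

theorem meas_eval {W ι β : Type*} [MeasurableSpace W] [MeasurableSpace β] [Countable ι]
    [MeasurableSpace ι] [MeasurableSingletonClass ι] {F : W → ι → β}
    (hF : ∀ i, Measurable fun w => F w i) {g : W → ι} (hg : Measurable g) :
    Measurable fun w => F w (g w) := by
  intro S hS
  have : (fun w => F w (g w)) ⁻¹' S = ⋃ i, (g ⁻¹' {i} ∩ (fun w => F w i) ⁻¹' S) := by
    ext w
    simp
  rw [this]
  exact MeasurableSet.iUnion fun i => (hg (measurableSet_singleton i)).inter (hF i hS)

theorem exists_enum {W : Type*} [MeasurableSpace W] (P : W → ℕ → Prop)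
    (hP : ∀ m, MeasurableSet {w | P w m}) (hinf : ∀ w, {m | P w m}.Infinite) :
    ∃ e : W → ℕ → ℕ, (∀ j, Measurable fun w => e w j) ∧ (∀ w, StrictMono (e w)) ∧
      ∀ w j, P w (e w j) := by
  have hcnt : ∀ m, Measurable fun w => Nat.count (P w) m := by
    intro m
    induction m with
    | zero => simp
    | succ m ih =>
      simp only [Nat.count_succ]
      exact ih.add (Measurable.ite (hP m) measurable_const measurable_const)
  refine ⟨fun w j => Nat.nth (P w) j, ?_, fun w => Nat.nth_strictMono (hinf w),
    fun w j => Nat.nth_mem_of_infinite (hinf w) j⟩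
  intro j
  refine measurable_to_countable' fun m => ?_
  have : (fun w => Nat.nth (P w) j) ⁻¹' {m} = {w | P w m} ∩ (fun w => Nat.count (P w) m) ⁻¹' {j} := by
    ext w
    simp only [mem_preimage, mem_singleton_iff, mem_inter_iff, mem_setOf_eq]
    constructor
    · rintro rfl
      exact ⟨Nat.nth_mem_of_infinite (hinf w) j, Nat.count_nth_of_infinite (hinf w) j⟩
    · rintro ⟨h1, rfl⟩
      exact Nat.nth_count h1
  rw [this]
  exact (hP m).inter (hcnt m (measurableSet_singleton j))

theorem borel_ramsey {W : Type*} [MeasurableSpace W] {k : ℕ} (n : ℕ) :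
    ∀ d : W → (Fin n → ℕ) → Fin k, (∀ v, Measurable fun w => d w v) →
    ∃ h : W → ℕ → ℕ, (∀ j, Measurable fun w => h w j) ∧ (∀ w, StrictMono (h w)) ∧
      ∀ w, ∃ a, ∀ v : Fin n → ℕ, StrictMono v → d w (h w ∘ v) = a := by
  induction n with
  | zero =>
    intro d hd
    refine ⟨fun _ j => j, fun j => measurable_const, fun w => strictMono_id, fun w =>
      ⟨d w default, fun v _ => ?_⟩⟩
    exact congrArg (d w) (Subsingleton.elim _ _)
  | succ n ih =>
    intro d hd
    let St := {t : W → ℕ → ℕ // (∀ j, Measurable fun w => t w j) ∧ ∀ w, StrictMono (t w)}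
    have step : ∀ t : St, ∃ (t' : St) (b : W → Fin k), Measurable b ∧
        (∀ w j, ∃ i, t'.1 w j = t.1 w (i + 1)) ∧
        ∀ w (v : Fin n → ℕ), StrictMono v →
          d w (Fin.cons (α := fun _ => ℕ) (t.1 w 0) (t'.1 w ∘ v)) = b w := by
      rintro ⟨t, ht1, ht2⟩
      have hd' : ∀ v : Fin n → ℕ, Measurable fun w =>
          d w (Fin.cons (α := fun _ => ℕ) (t w 0) (fun l => t w (v l + 1))) := by
        intro v
        refine meas_eval hd ?_
        refine measurable_pi_lambda _ fun l => ?_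
        refine Fin.cases ?_ (fun l => ?_) l
        · simpa using ht1 0
        · simpa using ht1 (v l + 1)
      obtain ⟨h, hh1, hh2, hh3⟩ := ih _ hd'
      refine ⟨⟨fun w j => t w (h w j + 1), ?_, ?_⟩, fun w =>
        d w (Fin.cons (α := fun _ => ℕ) (t w 0) (fun l : Fin n => t w (h w l + 1))), ?_, ?_, ?_⟩
      · intro j
        exact meas_eval ht1 ((hh1 j).add measurable_const)
      · intro w i j hij
        exact ht2 w (Nat.succ_lt_succ (hh2 w hij))
      · refine meas_eval hd ?_
        refine measurable_pi_lambda _ fun l => ?_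
        refine Fin.cases ?_ (fun l => ?_) l
        · simpa using ht1 0
        · simpa using meas_eval ht1 ((hh1 l).add (measurable_const (a := 1)))
      · intro w j
        exact ⟨_, rfl⟩
      · intro w v hv
        obtain ⟨a, ha⟩ := hh3 w
        exact (ha v hv).trans (ha (fun l => (l : ℕ)) Fin.val_strictMono).symm
    choose nxt col hcol hsub hcons using step
    let t : ℕ → St := fun i => Nat.rec ⟨fun _ j => j, fun j => measurable_const,
      fun _ => strictMono_id⟩ (fun _ s => nxt s) i
    have ht : ∀ i, t (i + 1) = nxt (t i) := fun i => rfl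
    let a : W → ℕ → ℕ := fun w i => (t i).1 w 0
    let b : W → ℕ → Fin k := fun w i => col (t i) w
    have ham : ∀ i, Measurable fun w => a w i := fun i => (t i).2.1 0
    have hbm : ∀ i, Measurable fun w => b w i := fun i => hcol (t i)
    have hrange : ∀ w, Antitone fun i => range ((t i).1 w) := by
      intro w
      refine antitone_nat_of_succ_le fun i => ?_
      rintro _ ⟨j, rfl⟩
      obtain ⟨l, hl⟩ := hsub (t i) w j
      exact ⟨l + 1, hl.symm⟩
    have hamono : ∀ w, StrictMono (a w) := by
      intro w
      refine strictMono_nat_of_lt_succ fun i => ?_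
      obtain ⟨l, hl⟩ := hsub (t i) w 0
      change (t i).1 w 0 < (nxt (t i)).1 w 0
      rw [hl]
      exact (t i).2.2 w (Nat.succ_pos l)
    have hab : ∀ w i (v : Fin n → ℕ), StrictMono v → (∀ l, i < v l) →
        d w (Fin.cons (α := fun _ => ℕ) (a w i) (a w ∘ v)) = b w i := by
      intro w i v hv hiv
      have hex : ∀ l, ∃ j, (t (i + 1)).1 w j = a w (v l) := fun l =>
        hrange w (Nat.succ_le_of_lt (hiv l)) ⟨0, rfl⟩
      choose v' hv' using hex
      have hmono : StrictMono v' := by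
        intro l m hlm
        rw [← ((t (i + 1)).2.2 w).lt_iff_lt, hv', hv']
        exact hamono w (hv hlm)
      have := hcons (t i) w v' hmono
      rw [← ht] at this
      have e : a w ∘ v = (t (i + 1)).1 w ∘ v' := by
        funext l
        exact (hv' l).symm
      rw [e]
      exact this
    have hQ : ∀ w, ∃ q : ℕ, ∀ N, ∃ m, N ≤ m ∧ (b w m : ℕ) = q := by
      intro w
      obtain ⟨y, hy⟩ := Finite.exists_infinite_fiber (b w)
      refine ⟨y, fun N => ?_⟩
      obtain ⟨m, hm, hm'⟩ := (Set.infinite_coe_iff.1 hy).exists_gt N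
      refine ⟨m, hm'.le, ?_⟩
      rw [show b w m = y from hm]
    have hbm' : ∀ m q, MeasurableSet {w | (b w m : ℕ) = q} := fun m q =>
      hbm m (t := {x : Fin k | (x : ℕ) = q}) (Set.toFinite _).measurableSet
    have hQm : Measurable fun w => Nat.find (hQ w) := by
      refine measurable_find hQ fun q => ?_
      have : {w | ∀ N, ∃ m, N ≤ m ∧ (b w m : ℕ) = q} =
          ⋂ N, ⋃ m, ⋃ _ : N ≤ m, {w | (b w m : ℕ) = q} := by
        ext w
        simp
      rw [this]
      exact MeasurableSet.iInter fun N => MeasurableSet.iUnion fun m =>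
        MeasurableSet.iUnion fun _ => hbm' m q
    obtain ⟨e, he1, he2, he3⟩ := exists_enum (fun w m => (b w m : ℕ) = Nat.find (hQ w))
      (fun m => measurableSet_eq_fun (f := fun w => (b w m : ℕ))
        (measurable_from_top.comp (hbm m)) hQm)
      (fun w => by
        rw [Set.infinite_iff_exists_gt]
        intro N
        obtain ⟨m, hm, hm'⟩ := Nat.find_spec (hQ w) (N + 1)
        exact ⟨m, hm', hm⟩)
    refine ⟨fun w j => a w (e w j), fun j => meas_eval ham (he1 j),
      fun w => (hamono w).comp (he2 w), fun w => ⟨b w (e w 0), fun v hv => ?_⟩⟩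
    have h1 := hab w (e w (v 0)) (fun l => e w (v l.succ))
      (fun l m hlm => he2 w (hv (Fin.succ_lt_succ_iff.2 hlm)))
      (fun l => he2 w (hv (Fin.succ_pos l)))
    have h2 : b w (e w (v 0)) = b w (e w 0) := Fin.ext ((he3 w _).trans (he3 w _).symm)
    rw [← h2, ← h1]
    congr 1
    funext l
    refine Fin.cases ?_ (fun l => ?_) l
    · simp
    · simp

/-- Countable-to-one Borel maps are countable unions of injective Borel pieces. -/
theorem exists_pieces {X Z : Type*} [MeasurableSpace X] [StandardBorelSpace X]
    [MeasurableSpace Z] [StandardBorelSpace Z] {f : X → Z} (hf : Measurable f)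
    (hc : ∀ z, (f ⁻¹' {z}).Countable) :
    ∃ T : ℕ → Set X, (∀ m, MeasurableSet (T m)) ∧ (∀ m, InjOn f (T m)) ∧
      Pairwise (Function.onFun Disjoint T) ∧ ⋃ m, T m = univ := by
  have hsm : ISmall f univ := by
    letI := upgradeStandardBorel X
    letI := upgradeStandardBorel Z
    have hp0 : PolishSpace X := inferInstance
    obtain ⟨t', ht', hcont, hpol⟩ := hf.exists_continuous
    have hb : @BorelSpace X t' _ := by
      have := MeasureTheory.borel_eq_borel_of_le hpol hp0 ht'
      refine @BorelSpace.mk X t' _ ?_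
      rw [this]
      exact BorelSpace.measurable_eq
    letI mZ := TopologicalSpace.upgradeIsCompletelyMetrizable Z
    letI mX := @TopologicalSpace.upgradeIsCompletelyMetrizable X t' _
    exact @lusin_novikov X Z mX.toMetricSpace mX.toCompleteSpace _ _ hb _ _ _ f hcont hc
  obtain ⟨T, hT1, hT2, hT3⟩ := hsm
  have hne : (insert ∅ T).Nonempty := ⟨∅, mem_insert _ _⟩
  obtain ⟨S, hS⟩ := (hT1.insert ∅).exists_eq_range hne
  have hS' : ∀ m, MeasurableSet (S m) ∧ InjOn f (S m) := by
    intro m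
    have : S m ∈ insert ∅ T := hS ▸ mem_range_self m
    rcases this with h | h
    · rw [h]; simp
    · exact hT2 _ h
  refine ⟨disjointed S, fun m => MeasurableSet.disjointed (fun m => (hS' m).1) m,
    fun m => (hS' m).2.mono (disjointed_subset S m), disjoint_disjointed S, ?_⟩
  rw [iUnion_disjointed, eq_univ_iff_forall]
  intro x
  obtain ⟨t, ht, hxt⟩ := hT3 (mem_univ x)
  have : t ∈ range S := hS ▸ mem_insert_of_mem _ ht
  obtain ⟨m, rfl⟩ := this
  exact mem_iUnion.2 ⟨m, hxt⟩

end SBR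

/-- If `E` is smooth, then the strong Borel Ramsey property `E →_B (E)^n_k` holds
for all integers `n, k > 1`. -/
theorem smooth_implies_strong_borel_ramsey {X : Type*} [MeasurableSpace X] [StandardBorelSpace X]
    (E : X → X → Prop) (hE : Equivalence E)
    (hEBorel : MeasurableSet {p : X × X | E p.1 p.2})
    (hcount : ∀ x : X, {y | E x y}.Countable)
    (haper : ∀ x : X, {y | E x y}.Infinite)
    (hsmooth : IsSmooth E) :
    ∀ n k : ℕ, 1 < n → 1 < k → StrongBorelRamsey E n k := by
  classical
  obtain ⟨Z, mZ, hZ, f, hf, hEf⟩ := hsmooth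
  intro n k hn hk c hc
  rcases isEmpty_or_nonempty X with hX | hX
  · exact ⟨∅, MeasurableSet.empty, fun x => hX.elim x, fun x => hX.elim x⟩
  have hfib : ∀ x, f ⁻¹' {f x} = {y | E x y} := by
    intro x
    ext y
    simp only [Set.mem_preimage, Set.mem_singleton_iff, Set.mem_setOf_eq, hEf]
    exact eq_comm
  have hcz : ∀ z, (f ⁻¹' {z}).Countable := by
    intro z
    by_cases hz : ∃ x, f x = z
    · obtain ⟨x, rfl⟩ := hz
      rw [hfib]
      exact hcount x
    · have : f ⁻¹' {z} = ∅ := by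
        rw [Set.eq_empty_iff_forall_notMem]
        exact fun x hx => hz ⟨x, hx⟩
      rw [this]
      exact Set.countable_empty
  obtain ⟨T, hT1, hT2, hT3, hT4⟩ := SBR.exists_pieces hf hcz
  -- Borel inverses
  have hinv : ∀ m, ∃ g : Z → X, Measurable g ∧ ∀ x ∈ T m, g (f x) = x := by
    intro m
    have : StandardBorelSpace (T m) := (hT1 m).standardBorel
    have hemb : MeasurableEmbedding (fun x : T m => f x) :=
      (hf.comp measurable_subtype_coe).measurableEmbedding
        (fun x y hxy => Subtype.ext (hT2 m x.2 y.2 hxy))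
    obtain ⟨g, hg1, hg2⟩ := hemb.exists_measurable_extend (g := fun x : T m => (x : X))
      measurable_subtype_coe (fun _ => hX)
    exact ⟨g, hg1, fun x hx => congrFun hg2 ⟨x, hx⟩⟩
  choose g hg1 hg2 using hinv
  let W := {z : Z // z ∈ Set.range f}
  let P : W → ℕ → Prop := fun w m => (w : Z) ∈ f '' T m
  have hP : ∀ m, MeasurableSet {w | P w m} := fun m =>
    measurable_subtype_coe ((hT1 m).image_of_measurable_injOn hf (hT2 m))
  have hgP : ∀ w m, P w m → g m w ∈ T m ∧ f (g m w) = w := by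
    rintro ⟨_, _⟩ m ⟨x, hx, rfl⟩
    dsimp only
    rw [hg2 m x hx]
    exact ⟨hx, rfl⟩
  have hinf : ∀ w, {m | P w m}.Infinite := by
    rintro ⟨_, x, rfl⟩ hfin
    apply haper x
    refine (hfin.image (fun m => g m (f x))).subset ?_
    intro y hy
    have hxy : f x = f y := (hEf x y).1 hy
    have hyT : y ∈ ⋃ m, T m := hT4 ▸ Set.mem_univ y
    obtain ⟨m, hm⟩ := Set.mem_iUnion.1 hyT
    refine ⟨m, ⟨y, hm, hxy.symm⟩, ?_⟩
    dsimp only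
    rw [hxy]
    exact hg2 m y hm
  obtain ⟨e, he1, he2, he3⟩ := SBR.exists_enum P hP hinf
  let F : W → ℕ → X := fun w i => g (e w i) w
  have hFm : ∀ i, Measurable fun w => F w i := fun i =>
    SBR.meas_eval (F := fun (w : W) m => g m w)
      (fun m => (hg1 m).comp measurable_subtype_coe) (he1 i)
  have hFf : ∀ w i, f (F w i) = w := fun w i => (hgP w _ (he3 w i)).2
  have hFinj : ∀ w, Function.Injective (F w) := by
    intro w i j hij
    apply (he2 w).injective
    by_contra hne
    have h1 := (hgP w _ (he3 w i)).1
    have h2 := (hgP w _ (he3 w j)).1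
    have h3 : F w i ∈ T (e w j) := by rw [hij]; exact h2
    exact Set.disjoint_left.1 (hT3 hne) h1 h3
  obtain ⟨h, hh1, hh2, hh3⟩ := SBR.borel_ramsey n
    (fun (w : W) (v : Fin n → ℕ) => c (Set.finite_range fun l => F w (v l)).toFinset)
    (fun v => hc.comp (measurable_pi_lambda (fun (w : W) l => F w (v l)) fun l => hFm (v l)))
  let f' : X → W := fun x => ⟨f x, x, rfl⟩
  have hf' : Measurable f' := hf.subtype_mk
  let G : W → ℕ → X := fun w j => F w (h w j)
  have hGm : ∀ j, Measurable fun w => G w j := fun j => SBR.meas_eval hFm (hh1 j)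
  have hGinj : ∀ w, Function.Injective (G w) := fun w => (hFinj w).comp (hh2 w).injective
  have hGf : ∀ w j, f (G w j) = w := fun w j => hFf w _
  have hGf' : ∀ w j, f' (G w j) = w := fun w j => Subtype.ext (hGf w j)
  refine ⟨{y | ∃ j, y = G (f' y) j}, ?_, ?_, ?_⟩
  · rw [Set.setOf_exists]
    refine MeasurableSet.iUnion fun j => ?_
    letI := upgradeStandardBorel X
    exact measurableSet_eq_fun measurable_id ((hGm j).comp hf')
  · intro x
    refine (Set.infinite_range_of_injective (hGinj (f' x))).mono ?_
    rintro _ ⟨j, rfl⟩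
    refine ⟨⟨j, ?_⟩, ?_⟩
    · rw [hGf']
    · rw [hEf, hGf]
  · intro x
    obtain ⟨a, ha⟩ := hh3 (f' x)
    refine ⟨a, fun A hA hAY hAE => ?_⟩
    have hpre : ∀ y ∈ A, ∃ j, G (f' x) j = y := by
      intro y hy
      obtain ⟨j, hj⟩ := hAY hy
      have : f' x = f' y := Subtype.ext ((hEf x y).1 (hAE y hy))
      exact ⟨j, by rw [this]; exact hj.symm⟩
    let B : Finset ℕ := A.preimage (G (f' x)) (hGinj _).injOn
    have hBA : B.image (G (f' x)) = A := by
      ext y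
      simp only [B, Finset.mem_image, Finset.mem_preimage]
      constructor
      · rintro ⟨j, hj, rfl⟩
        exact hj
      · intro hy
        obtain ⟨j, hj⟩ := hpre y hy
        exact ⟨j, hj ▸ hy, hj⟩
    have hB : B.card = n := by
      rw [← hA, ← hBA, Finset.card_image_of_injective _ (hGinj _)]
    have hfin := ha (B.orderEmbOfFin hB) (B.orderEmbOfFin hB).strictMono
    rw [← hfin]
    congr 1
    ext y
    rw [← hBA]
    simp only [Set.Finite.mem_toFinset, Finset.mem_image, Set.mem_range]
    constructor
    · rintro ⟨j, hj, rfl⟩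
      have : j ∈ Set.range (B.orderEmbOfFin hB) := by
        rw [Finset.range_orderEmbOfFin]
        exact hj
      obtain ⟨l, rfl⟩ := this
      exact ⟨l, rfl⟩
    · rintro ⟨l, rfl⟩
      exact ⟨_, Finset.orderEmbOfFin_mem B hB l, rfl⟩
end
end

section
/- Let X be a standard Borel space, let E be an aperiodic, countable Borel equivalence relation on X, and let n, k > 1 be integers. If the strong Borel Ramsey property E →_B (E)^n_k holds, then for every Borel infinite complete section Y ⊆ X, the strong Borel Ramsey property F →_B (F)^n_k holds, where F = E restricted to Y. -/
open Classical

noncomputable section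

open MeasureTheory Topology

namespace LN

def Sig {W X : Type*} [MeasurableSpace W] (f : W → X) (G : Set W) : Prop :=
  ∃ D : Set (Set W), D.Countable ∧ (∀ d ∈ D, MeasurableSet d ∧ Set.InjOn f d) ∧ G = ⋃₀ D

lemma Sig.measurableSet {W X : Type*} [MeasurableSpace W] {f : W → X} {G : Set W}
    (h : Sig f G) : MeasurableSet G := by
  obtain ⟨D, hD, h1, rfl⟩ := h
  exact MeasurableSet.sUnion hD fun d hd => (h1 d hd).1

lemma Sig.iUnion {W X ι : Type*} [Countable ι] [MeasurableSpace W] {f : W → X} {G : ι → Set W}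
    (h : ∀ i, Sig f (G i)) : Sig f (⋃ i, G i) := by
  choose D hD h1 h2 using h
  refine ⟨⋃ i, D i, Set.countable_iUnion hD, ?_, ?_⟩
  · intro d hd
    obtain ⟨i, hi⟩ := Set.mem_iUnion.1 hd
    exact h1 i d hi
  · rw [Set.sUnion_iUnion]
    exact Set.iUnion_congr h2

lemma Sig.union {W X : Type*} [MeasurableSpace W] {f : W → X} {G : Set W}
    (h : Sig f G) {d : Set W} (hd : MeasurableSet d) (hi : Set.InjOn f d) : Sig f (G ∪ d) := by
  obtain ⟨D, hD, h1, rfl⟩ := h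
  refine ⟨insert d D, hD.insert d, ?_, ?_⟩
  · rintro e (rfl | he)
    · exact ⟨hd, hi⟩
    · exact h1 e he
  · rw [Set.sUnion_insert, Set.union_comm]

def NonSmall {W X : Type*} [MeasurableSpace W] (f : W → X) (A : Set (Set W)) : Prop :=
  ∀ G, Sig f G → ∃ x, ∀ a ∈ A, ∃ w ∈ a, w ∉ G ∧ f w = x

lemma NonSmall.mono {W X : Type*} [MeasurableSpace W] {f : W → X} {A B : Set (Set W)}
    (h : NonSmall f A) (hB : ∀ b ∈ B, ∃ a ∈ A, a ⊆ b) : NonSmall f B := by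
  intro G hG
  obtain ⟨x, hx⟩ := h G hG
  refine ⟨x, fun b hb => ?_⟩
  obtain ⟨a, ha, hab⟩ := hB b hb
  obtain ⟨w, hw, h1⟩ := hx a ha
  exact ⟨w, hab hw, h1⟩

/-- An analytic set on which `f` is injective is contained in a Borel one. -/
lemma borel_graph {W X : Type*} [TopologicalSpace W] [PolishSpace W] [MeasurableSpace W]
    [BorelSpace W] [TopologicalSpace X] [PolishSpace X] [MeasurableSpace X] [BorelSpace X]
    {f : W → X} (hf : Continuous f) (M : Set W) (hM : MeasurableSet M) (R : Set X)
    (hR : AnalyticSet R) (hinj : Set.InjOn f (M ∩ f ⁻¹' R)) :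
    ∃ D, MeasurableSet D ∧ Set.InjOn f D ∧ M ∩ f ⁻¹' R ⊆ D := by
  have key : ∀ U ∈ TopologicalSpace.countableBasis W, ∃ B : Set X, MeasurableSet B ∧
      ∀ w ∈ M ∩ f ⁻¹' R, (w ∈ U ↔ f w ∈ B) := by
    intro U hU
    have hUo := TopologicalSpace.isOpen_of_mem_countableBasis hU
    have an : ∀ N : Set W, MeasurableSet N → AnalyticSet (f '' N ∩ R) := by
      intro N hN
      rw [Set.inter_eq_iInter]
      apply AnalyticSet.iInter
      rintro (_ | _)
      · exact hR
      · exact hN.analyticSet.image_of_continuous hf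
    obtain ⟨B, h1, h2, h3⟩ := (an (M ∩ U) (hM.inter hUo.measurableSet)).measurablySeparable
      (an (M ∩ Uᶜ) (hM.inter hUo.measurableSet.compl)) (by
        rw [Set.disjoint_left]
        rintro x ⟨⟨w, hw, rfl⟩, hx⟩ ⟨⟨w', hw', he⟩, -⟩
        have := hinj ⟨hw.1, hx⟩ ⟨hw'.1, by simpa [he] using hx⟩ he.symm
        exact hw'.2 (this ▸ hw.2))
    refine ⟨B, h3, fun w hw => ⟨fun h => h1 ⟨⟨w, ⟨hw.1, h⟩, rfl⟩, hw.2⟩, fun h => ?_⟩⟩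
    by_contra hwU
    exact Set.disjoint_left.1 h2 ⟨⟨w, ⟨hw.1, hwU⟩, rfl⟩, hw.2⟩ h
  choose! B hB hB' using key
  refine ⟨⋂ U ∈ TopologicalSpace.countableBasis W, {w | w ∈ U ↔ f w ∈ B U}, ?_, ?_, ?_⟩
  · refine MeasurableSet.biInter (TopologicalSpace.countable_countableBasis W) fun U hU => ?_
    have h1 : MeasurableSet {w | w ∈ U} :=
      (TopologicalSpace.isOpen_of_mem_countableBasis hU).measurableSet
    have h2 : MeasurableSet {w | f w ∈ B U} := hf.measurable (hB U hU)
    exact h1.iff h2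
  · intro w hw w' hw' he
    simp only [Set.mem_iInter, Set.mem_ofPred_eq] at hw hw'
    by_contra hne
    obtain ⟨t, ht, hwt, hts⟩ := (TopologicalSpace.isBasis_countableBasis W).mem_nhds_iff.1
      (isOpen_ne.mem_nhds hne)
    have := (hw' t ht).2 (he ▸ (hw t ht).1 hwt)
    exact hts this rfl
  · intro w hw
    simp only [Set.mem_iInter, Set.mem_ofPred_eq]
    exact fun U hU => hB' U hU w hw

def Good {W : Type*} [MetricSpace W] (ε : ℝ) (A U V : Set W) : Prop :=
  IsOpen U ∧ IsOpen V ∧ closure U ⊆ A ∧ closure V ⊆ A ∧ Disjoint (closure U) (closure V) ∧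
    (∀ a ∈ U, ∀ b ∈ U, dist a b ≤ ε) ∧ (∀ a ∈ V, ∀ b ∈ V, dist a b ≤ ε)

lemma split {W X : Type*} [MetricSpace W] [PolishSpace W] [MeasurableSpace W]
    [BorelSpace W] [TopologicalSpace X] [PolishSpace X] [MeasurableSpace X] [BorelSpace X]
    {f : W → X} (hf : Continuous f) (A : Set (Set W)) (hAc : A.Countable)
    (hAo : ∀ a ∈ A, IsOpen a) (hA : NonSmall f A) (a : Set W) (ha : a ∈ A) (ε : ℝ) (hε : 0 < ε) :
    ∃ U V, Good ε a U V ∧ NonSmall f (insert U (insert V A)) := by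
  by_contra hcon
  push Not at hcon
  let Bs := TopologicalSpace.countableBasis W
  have : Countable Bs := (TopologicalSpace.countable_countableBasis W).to_subtype
  let ι := {p : Bs × Bs // Good ε a p.1 p.2}
  have h1 : ∀ p : ι, ∃ G, Sig f G ∧ ¬ ∃ x, ∀ b ∈ insert (p.1.1 : Set W) (insert (p.1.2 : Set W) A),
      ∃ w ∈ b, w ∉ G ∧ f w = x := by
    intro p
    have := hcon _ _ p.2
    unfold NonSmall at this
    push Not at this
    obtain ⟨G, hG, h⟩ := this
    refine ⟨G, hG, ?_⟩
    push Not
    exact h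
  choose G hG hG' using h1
  have hGs : Sig f (⋃ p, G p) := Sig.iUnion hG
  set G0 := ⋃ p, G p with hG0
  let R : Set X := ⋂ b : A, f '' (b.1 \ G0)
  have hR : AnalyticSet R := by
    have : Countable A := hAc.to_subtype
    have : Nonempty A := ⟨⟨a, ha⟩⟩
    apply AnalyticSet.iInter
    intro b
    exact ((hAo b b.2).measurableSet.diff hGs.measurableSet).analyticSet.image_of_continuous hf
  have hinj : Set.InjOn f ((a \ G0) ∩ f ⁻¹' R) := by
    intro w hw w' hw' he
    by_contra hne
    obtain ⟨u, u', hu, hu', hwu, hwu', hd⟩ := t2_separation hne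
    have nb : ∀ z u, z ∈ a → z ∈ u → IsOpen u → ∃ t ∈ Bs, z ∈ t ∧
        closure t ⊆ (a ∩ u) ∩ Metric.ball z (ε/2) := by
      intro z u hz hzu hu
      exact (TopologicalSpace.isBasis_countableBasis W).exists_closure_subset
        ((((hAo a ha).inter hu).inter Metric.isOpen_ball).mem_nhds
          ⟨⟨hz, hzu⟩, Metric.mem_ball_self (by linarith)⟩)
    obtain ⟨U, hU, hwU, hUs⟩ := nb w u hw.1.1 hwu hu
    obtain ⟨V, hV, hwV, hVs⟩ := nb w' u' hw'.1.1 hwu' hu'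
    have dm : ∀ z : W, ∀ U u : Set W, closure U ⊆ (a ∩ u) ∩ Metric.ball z (ε/2) →
        ∀ b ∈ U, ∀ c ∈ U, dist b c ≤ ε := by
      intro z U u h b hb c hc
      have h1 := (h (subset_closure hb)).2
      have h2 := (h (subset_closure hc)).2
      rw [Metric.mem_ball] at h1 h2
      have := dist_triangle_right b c z
      linarith
    have good : Good ε a U V := ⟨TopologicalSpace.isOpen_of_mem_countableBasis hU,
      TopologicalSpace.isOpen_of_mem_countableBasis hV,
      fun z hz => (hUs hz).1.1, fun z hz => (hVs hz).1.1,
      hd.mono (fun z hz => (hUs hz).1.2) (fun z hz => (hVs hz).1.2), dm _ _ _ hUs, dm _ _ _ hVs⟩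
    let p : ι := ⟨(⟨U, hU⟩, ⟨V, hV⟩), good⟩
    have nG : ∀ z, z ∉ G0 → z ∉ G p := fun z hz hz' => hz (Set.mem_iUnion.2 ⟨p, hz'⟩)
    apply hG' p
    refine ⟨f w, ?_⟩
    rintro b (rfl | rfl | hb)
    · exact ⟨w, hwU, nG _ hw.1.2, rfl⟩
    · exact ⟨w', hwV, nG _ hw'.1.2, he.symm⟩
    · obtain ⟨z, hz, hzx⟩ := Set.mem_iInter.1 hw.2 ⟨b, hb⟩
      exact ⟨z, hz.1, nG _ hz.2, hzx⟩
  obtain ⟨D, hD, hDi, hDs⟩ := borel_graph hf (a \ G0)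
    ((hAo a ha).measurableSet.diff hGs.measurableSet) R hR hinj
  obtain ⟨x, hx⟩ := hA _ (hGs.union hD hDi)
  have hxR : x ∈ R := by
    refine Set.mem_iInter.2 fun b => ?_
    obtain ⟨w, hw, hw', rfl⟩ := hx b b.2
    exact ⟨w, ⟨hw, fun h => hw' (Or.inl h)⟩, rfl⟩
  obtain ⟨w, hw, hw', rfl⟩ := hx a ha
  exact hw' (Or.inr (hDs ⟨⟨hw, fun h => hw' (Or.inl h)⟩, hxR⟩))

lemma split_all {W X ι : Type*} [Finite ι] [MetricSpace W] [PolishSpace W] [MeasurableSpace W]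
    [BorelSpace W] [TopologicalSpace X] [PolishSpace X] [MeasurableSpace X] [BorelSpace X]
    {f : W → X} (hf : Continuous f) (A : ι → Set W)
    (hAo : ∀ i, IsOpen (A i)) (hA : NonSmall f (Set.range A)) (ε : ℝ) (hε : 0 < ε) :
    ∃ u : ι → Bool → Set W, (∀ i, Good ε (A i) (u i false) (u i true)) ∧
      NonSmall f {s | ∃ i b, u i b = s} := by
  have := Fintype.ofFinite ι
  have main : ∀ S : Finset ι, ∃ u : ι → Bool → Set W,
      (∀ i ∈ S, Good ε (A i) (u i false) (u i true)) ∧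
      NonSmall f (Set.range A ∪ {s | ∃ i ∈ S, ∃ b, u i b = s}) := by
    intro S
    induction S using Finset.induction_on with
    | empty => exact ⟨fun _ _ => ∅, by simp, by simpa using hA⟩
    | insert i0 S hi0 ih =>
      obtain ⟨u, hu, hN⟩ := ih
      obtain ⟨U, V, hUV, hN'⟩ := split hf _ (Set.Countable.union (Set.countable_range A)
        (by
          have : {s | ∃ i ∈ S, ∃ b, u i b = s} ⊆ Set.range (fun p : ι × Bool => u p.1 p.2) := by
            rintro s ⟨i, -, b, rfl⟩
            exact ⟨(i, b), rfl⟩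
          exact (Set.countable_range _).mono this)) (by
          rintro s (⟨i, rfl⟩ | ⟨i, hi, b, rfl⟩)
          · exact hAo i
          · cases b
            · exact (hu i hi).1
            · exact (hu i hi).2.1) hN (A i0) (Or.inl ⟨i0, rfl⟩) ε hε
      refine ⟨fun i b => if i = i0 then (if b then V else U) else u i b, ?_, ?_⟩
      · intro i hi
        by_cases h : i = i0
        · subst h; simpa using hUV
        · simpa [h] using hu i (Finset.mem_of_mem_insert_of_ne hi h)
      · refine hN'.mono ?_
        rintro s (⟨i, rfl⟩ | ⟨i, hi, b, rfl⟩)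
        · exact ⟨A i, by simp, le_rfl⟩
        · refine ⟨_, ?_, le_rfl⟩
          by_cases h : i = i0
          · cases b <;> simp [h]
          · have := Finset.mem_of_mem_insert_of_ne hi h
            simp only [h, if_false]
            exact Or.inr (Or.inr (Or.inr ⟨i, this, b, rfl⟩))
  obtain ⟨u, hu, hN⟩ := main Finset.univ
  refine ⟨u, fun i => hu i (Finset.mem_univ i), hN.mono ?_⟩
  rintro s ⟨i, b, rfl⟩
  exact ⟨_, Or.inr ⟨i, Finset.mem_univ i, b, rfl⟩, le_rfl⟩

lemma not_nonSmall {W X : Type*} [MetricSpace W] [CompleteSpace W] [PolishSpace W]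
    [MeasurableSpace W]
    [BorelSpace W] [TopologicalSpace X] [PolishSpace X] [MeasurableSpace X] [BorelSpace X]
    {f : W → X} (hf : Continuous f) (hc : ∀ x, (f ⁻¹' {x}).Countable) :
    ¬ NonSmall f {Set.univ} := by
  intro h0
  let St (n : ℕ) := {A : (Fin n → Bool) → Set W //
    (∀ i, IsOpen (A i)) ∧ NonSmall f (Set.range A)}
  have step : ∀ n (A : St n), ∃ A' : St (n + 1), ∀ s : Fin n → Bool,
      Good ((1/2 : ℝ)^n) (A.1 s) (A'.1 (Fin.snoc s false)) (A'.1 (Fin.snoc s true)) := by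
    intro n A
    obtain ⟨u, hu, hN⟩ := split_all hf A.1 A.2.1 A.2.2 ((1/2 : ℝ)^n) (by positivity)
    refine ⟨⟨fun s => u (Fin.init s) (s (Fin.last n)), ?_, ?_⟩, ?_⟩
    · intro i
      show IsOpen (u (Fin.init i) (i (Fin.last n)))
      cases i (Fin.last n)
      · exact (hu _).1
      · exact (hu _).2.1
    · refine hN.mono ?_
      rintro s ⟨i, rfl⟩
      exact ⟨_, ⟨_, _, rfl⟩, le_rfl⟩
    · intro s
      simpa using hu s
  choose nx hnx using step
  let T : ∀ n, St n := fun n => Nat.rec (motive := St) ⟨fun _ => Set.univ, fun _ => isOpen_univ,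
    h0.mono (by rintro s ⟨i, rfl⟩; exact ⟨_, rfl, le_rfl⟩)⟩ (fun n A => nx n A) n
  have hT : ∀ n, ∀ s : Fin n → Bool, Good ((1/2 : ℝ)^n) ((T n).1 s) ((T (n+1)).1 (Fin.snoc s false))
    ((T (n+1)).1 (Fin.snoc s true)) := fun n => hnx n (T n)
  have hx : ∀ n, ∃ x, ∀ s, ∃ w ∈ (T n).1 s, f w = x := by
    intro n
    obtain ⟨x, hx⟩ := (T n).2.2 ∅ ⟨∅, by simp, by simp, by simp⟩
    refine ⟨x, fun s => ?_⟩
    obtain ⟨w, hw, -, h⟩ := hx _ ⟨s, rfl⟩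
    exact ⟨w, hw, h⟩
  choose x w hw hwx using hx
  let B (α : ℕ → Bool) (n : ℕ) : Set W := (T n).1 (fun i => α i)
  have hs : ∀ (α : ℕ → Bool) n, (fun i : Fin (n+1) => α i) =
      Fin.snoc (α := fun _ => Bool) (fun i : Fin n => α i) (α n) := by
    intro α n
    ext i
    refine Fin.lastCases ?_ (fun j => ?_) i <;> simp
  have hB : ∀ α n, closure (B α (n+1)) ⊆ B α n ∧
      ∀ a ∈ B α (n+1), ∀ b ∈ B α (n+1), dist a b ≤ (1/2 : ℝ)^n := by
    intro α n
    have := hT n (fun i => α i)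
    simp only [B, hs α n]
    cases α n
    · exact ⟨this.2.2.1, this.2.2.2.2.2.1⟩
    · exact ⟨this.2.2.2.1, this.2.2.2.2.2.2⟩
  have hanti : ∀ α, Antitone (B α) := fun α => antitone_nat_of_succ_le fun n =>
    subset_closure.trans (hB α n).1
  let p (α : ℕ → Bool) (n : ℕ) : W := w n (fun i => α i)
  have hp : ∀ α n, p α n ∈ B α n := fun α n => hw n _
  have hlim : ∀ α, ∃ z, Filter.Tendsto (p α) Filter.atTop (𝓝 z) := by
    intro α
    apply cauchySeq_tendsto_of_complete
    rw [← cauchySeq_shift 1]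
    apply cauchySeq_of_le_geometric (1/2) 1 (by norm_num)
    intro n
    rw [one_mul]
    exact (hB α n).2 _ (hp α (n+1)) _ (hanti α (Nat.le_succ _) (hp α (n+1+1)))
  choose z hz using hlim
  have hzc : ∀ α n, z α ∈ closure (B α n) := by
    intro α n
    refine mem_closure_of_tendsto (hz α) ?_
    filter_upwards [Filter.eventually_ge_atTop n] with m hm
    exact hanti α hm (hp α m)
  have hzi : Function.Injective z := by
    intro α β he
    by_contra hne
    have hex : ∃ n, α n ≠ β n := Function.ne_iff.1 hne
    have hfind := Nat.find_spec hex
    have hmin : ∀ m < Nat.find hex, α m = β m := fun m hm => by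
      simpa using Nat.find_min hex hm
    generalize Nat.find hex = n at hfind hmin
    have h1 := hzc α (n+1)
    have h2 := hzc β (n+1)
    rw [← he] at h2
    have hαβ : (fun i : Fin n => α i) = fun i : Fin n => β i := by
      ext i; exact hmin i i.2
    simp only [B, hs] at h1 h2
    rw [hαβ] at h1
    have hd := (hT n (fun i => β i)).2.2.2.2.1
    revert h1 h2 hfind
    cases α n <;> cases β n <;> intro hfind h1 h2
    · exact hfind rfl
    · exact Set.disjoint_left.1 hd h1 h2
    · exact Set.disjoint_left.1 hd h2 h1
    · exact hfind rfl
  have hfz : ∀ α, Filter.Tendsto x Filter.atTop (𝓝 (f (z α))) := by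
    intro α
    have := (hf.tendsto (z α)).comp (hz α)
    refine this.congr fun n => ?_
    exact hwx n _
  have hcl : Set.range z ⊆ f ⁻¹' {f (z fun _ => false)} := by
    rintro _ ⟨α, rfl⟩
    exact tendsto_nhds_unique (hfz α) (hfz _)
  have hcr := (hc _).mono hcl
  have h2 : Cardinal.mk (ℕ → Bool) = Cardinal.continuum := by simp
  have : Countable (ℕ → Bool) := by
    have := hcr.to_subtype
    exact (Set.rangeFactorization_injective.2 hzi).countable
  have h1 : Cardinal.mk (ℕ → Bool) ≤ Cardinal.aleph0 := Cardinal.mk_le_aleph0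
  rw [h2] at h1
  exact absurd Cardinal.aleph0_lt_continuum (not_lt.2 h1)

/-- Lusin–Novikov. -/
theorem lusin_novikov {W X : Type*} [MeasurableSpace W] [StandardBorelSpace W]
    [MeasurableSpace X] [StandardBorelSpace X] {f : W → X} (hf : Measurable f)
    (hc : ∀ x, (f ⁻¹' {x}).Countable) :
    ∃ D : ℕ → Set W, (∀ i, MeasurableSet (D i) ∧ Set.InjOn f (D i)) ∧ ⋃ i, D i = Set.univ := by
  have hS : Sig f Set.univ := by
    let := upgradeStandardBorel X
    obtain ⟨tW, hbW, hpW⟩ := StandardBorelSpace.polish (α := W)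
    obtain ⟨t', ht', hcont, hpol⟩ := hf.exists_continuous
    have hbor : @BorelSpace W t' _ := by
      constructor
      rw [borel_eq_borel_of_le hpol hpW ht']
      exact hbW.measurable_eq
    clear ht' hbW hpW
    clear tW
    let := t'
    let := TopologicalSpace.upgradeIsCompletelyMetrizable W
    have := not_nonSmall hcont hc
    unfold NonSmall at this
    push Not at this
    obtain ⟨G, hG, h⟩ := this
    have : G = Set.univ := by
      ext w
      simp only [Set.mem_univ, iff_true]
      by_contra hw
      obtain ⟨a, rfl, ha⟩ := h (f w)
      exact ha w trivial hw rfl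
    rwa [← this]
  obtain ⟨D, hD, h1, h2⟩ := hS
  have hD' : (insert ∅ D).Countable := hD.insert _
  obtain ⟨g, hg⟩ := hD'.exists_eq_range (Set.insert_nonempty _ _)
  refine ⟨g, fun i => ?_, ?_⟩
  · have : g i ∈ insert ∅ D := hg ▸ ⟨i, rfl⟩
    rcases this with h | h
    · rw [h]; simp
    · exact h1 _ h
  · rw [← Set.sUnion_range, ← hg, Set.sUnion_insert, ← h2]; simp

end LN

namespace LN

lemma enum {X : Type*} [MeasurableSpace X] [StandardBorelSpace X]
    (E : X → X → Prop) (hE : Equivalence E)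
    (hEBorel : MeasurableSet {p : X × X | E p.1 p.2})
    (hcount : ∀ x : X, {y | E x y}.Countable) :
    ∃ g : ℕ → X → X, (∀ i, Measurable (g i)) ∧ ∀ x y, E x y ↔ ∃ i, g i x = y := by
  let W := {p : X × X | E p.1 p.2}
  have : StandardBorelSpace W := hEBorel.standardBorel
  let f : W → X := fun w => w.1.1
  let sn : W → X := fun w => w.1.2
  have hf : Measurable f := measurable_fst.comp measurable_subtype_coe
  have hsn : Measurable sn := measurable_snd.comp measurable_subtype_coe
  obtain ⟨D, hD, hU⟩ := lusin_novikov hf (by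
    intro x
    refine Set.MapsTo.countable_of_injOn (f := sn) (t := {y | E x y}) ?_ ?_ (hcount x)
    · rintro ⟨⟨a, b⟩, h⟩ rfl
      exact h
    · rintro ⟨⟨a, b⟩, h⟩ rfl ⟨⟨a', b'⟩, h'⟩ h1 h2
      simp only [f, sn, Set.mem_preimage, Set.mem_singleton_iff] at h1 h2
      subst h1 h2
      rfl)
  let g : ℕ → X → X := fun i x => if h : ∃ w ∈ D i, f w = x then sn h.choose else x
  have hg1 : ∀ i, ∀ w ∈ D i, g i (f w) = sn w := by
    intro i w hw
    have h : ∃ w' ∈ D i, f w' = f w := ⟨w, hw, rfl⟩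
    simp only [g, dif_pos h]
    rw [(hD i).2 h.choose_spec.1 hw h.choose_spec.2]
  have hg2 : ∀ i x, x ∉ f '' D i → g i x = x := by
    intro i x hx
    exact dif_neg hx
  refine ⟨g, fun i B hB => ?_, fun x y => ⟨fun h => ?_, ?_⟩⟩
  · have : g i ⁻¹' B = f '' (D i ∩ sn ⁻¹' B) ∪ ((f '' D i)ᶜ ∩ B) := by
      ext x
      by_cases hx : x ∈ f '' D i
      · obtain ⟨w, hw, rfl⟩ := hx
        rw [Set.mem_preimage, hg1 i w hw]
        constructor
        · exact fun h => Or.inl ⟨w, ⟨hw, h⟩, rfl⟩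
        · rintro (⟨w', ⟨hw', h⟩, he⟩ | ⟨h, -⟩)
          · rwa [← (hD i).2 hw' hw he]
          · exact absurd ⟨w, hw, rfl⟩ h
      · rw [Set.mem_preimage, hg2 i x hx]
        constructor
        · exact fun h => Or.inr ⟨hx, h⟩
        · rintro (⟨w', ⟨hw', h⟩, he⟩ | ⟨-, h⟩)
          · exact absurd ⟨w', hw', he⟩ hx
          · exact h
    rw [this]
    refine MeasurableSet.union ?_ (MeasurableSet.inter (MeasurableSet.compl ?_) hB)
    · exact ((hD i).1.inter (hsn hB)).image_of_measurable_injOn hf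
        ((hD i).2.mono Set.inter_subset_left)
    · exact (hD i).1.image_of_measurable_injOn hf (hD i).2
  · have : (⟨(x, y), h⟩ : W) ∈ ⋃ i, D i := hU ▸ trivial
    obtain ⟨i, hi⟩ := Set.mem_iUnion.1 this
    exact ⟨i, hg1 i _ hi⟩
  · rintro ⟨i, rfl⟩
    by_cases hx : x ∈ f '' D i
    · obtain ⟨w, hw, rfl⟩ := hx
      rw [hg1 i w hw]
      exact w.2
    · rw [hg2 i x hx]
      exact hE.refl x

lemma ram {X : Type*} [MeasurableSpace X]
    (E : X → X → Prop) (hE : Equivalence E) (n k : ℕ)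
    (hRamsey : StrongBorelRamsey E n k) (Y : Set X)
    (f : X → Y) (hf : Measurable f) (hfE : ∀ x, E x (f x))
    (c : Finset Y → Fin k) (hc : IsBorelColoring n c) :
    ∃ Z : Set X, MeasurableSet Z ∧ IsInfiniteCompleteSection E Z ∧
      IsMonochromatic (fun a b : Y => E a b) n c (f '' Z) := by
  obtain ⟨Z, hZ, hZi, hZm⟩ := hRamsey (fun A => c (A.image f)) (by
    have h1 : Measurable fun v : Fin n → X => fun i => f (v i) :=
      measurable_pi_lambda _ fun i => hf.comp (measurable_pi_apply i)
    have := Measurable.comp hc h1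
    unfold IsBorelColoring
    convert this using 2 with v
    simp only [Function.comp]
    congr 1
    ext y
    simp)
  refine ⟨Z, hZ, hZi, fun y => ?_⟩
  obtain ⟨a, ha⟩ := hZm y
  refine ⟨a, fun A hA hAs hAE => ?_⟩
  have hpre : ∀ t ∈ A, ∃ z ∈ Z, f z = t := fun t ht => hAs ht
  have hne : Nonempty X := ⟨y⟩
  choose! q hq hq' using hpre
  have him : (A.image q).image f = A := by
    rw [Finset.image_image]
    ext t
    simp only [Finset.mem_image, Function.comp]
    constructor
    · rintro ⟨b, hb, rfl⟩
      rwa [hq' b hb]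
    · exact fun ht => ⟨t, ht, hq' t ht⟩
  have := ha (A.image q) ?_ ?_ ?_
  · simpa only [him] using this
  · rw [Finset.card_image_of_injOn, hA]
    intro s hs t ht he
    rw [← hq' s hs, ← hq' t ht, he]
  · intro z hz
    simp only [Finset.coe_image, Set.mem_image] at hz
    obtain ⟨t, ht, rfl⟩ := hz
    exact hq t ht
  · intro z hz
    obtain ⟨t, ht, rfl⟩ := Finset.mem_image.1 hz
    have := hfE (q t)
    rw [hq' t ht] at this
    exact hE.trans (hAE t ht) (hE.symm this)

lemma smooth_part {X : Type*} [MeasurableSpace X] [StandardBorelSpace X]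
    (E : X → X → Prop) (hE : Equivalence E) (g : ℕ → X → X) (hg : ∀ i, Measurable (g i))
    (hgE : ∀ x y, E x y ↔ ∃ i, g i x = y)
    (Y : Set X) (hY : MeasurableSet Y) (hYsec : IsInfiniteCompleteSection E Y)
    (f : X → Y) (hf : Measurable f) (hfE : ∀ x, E x (f x))
    (V S : Set X) (hV : MeasurableSet V) (hS : MeasurableSet S)
    (hSV : ∀ x ∈ S, {y | y ∈ V ∧ E x y}.Finite) (hVn : ∀ x, ∃ y ∈ V, E x y)
    (hSi : ∀ x y, E x y → x ∈ S → y ∈ S) :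
    ∃ f' : X → Y, Measurable f' ∧ (∀ x, E x (f' x)) ∧
      ∀ x ∈ S, ∀ y, {z | E x z ∧ f' z = y}.Finite := by
  let e := embeddingReal X
  have he : Measurable e := measurable_embeddingReal X
  have hei : Function.Injective e := (measurableEmbedding_embeddingReal X).injective
  have hEg : ∀ i x, E x (g i x) := fun i x => (hgE x _).2 ⟨i, rfl⟩
  let P : ℕ → X → Prop := fun i x =>
    x ∈ S → (g i x ∈ V ∧ ∀ j, g j x ∈ V → e (g i x) ≤ e (g j x))
  have hPex : ∀ x, ∃ i, P i x := by
    intro x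
    by_cases hx : x ∈ S
    · have hne : {y | y ∈ V ∧ E x y}.Nonempty := hVn x
      obtain ⟨y, hy, hmin⟩ := Set.exists_min_image _ e (hSV x hx) hne
      obtain ⟨i, hi⟩ := (hgE x y).1 hy.2
      refine ⟨i, fun _ => ⟨hi ▸ hy.1, fun j hj => ?_⟩⟩
      rw [hi]
      exact hmin _ ⟨hj, hEg j x⟩
    · exact ⟨0, fun h => absurd h hx⟩
  have hPm : ∀ i, MeasurableSet {x | P i x} := by
    intro i
    refine MeasurableSet.imp hS (MeasurableSet.inter (hg i hV) ?_)
    refine (MeasurableSet.iInter fun j => MeasurableSet.imp (hg j hV)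
      (measurableSet_le (he.comp (hg i)) (he.comp (hg j)))).congr ?_
    ext x; simp; exact Iff.rfl
  let s : X → X := fun x => g (Nat.find (hPex x)) x
  have hsm : Measurable s := Measurable.find hg hPm hPex
  have hsE : ∀ x, E x (s x) := fun x => hEg _ x
  have hsp : ∀ x ∈ S, s x ∈ V ∧ ∀ y ∈ V, E x y → e (s x) ≤ e y := by
    intro x hx
    have := Nat.find_spec (hPex x) hx
    refine ⟨this.1, fun y hy hxy => ?_⟩
    obtain ⟨j, rfl⟩ := (hgE x y).1 hxy
    exact this.2 j hy
  have hsinv : ∀ x y, E x y → x ∈ S → s x = s y := by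
    intro x y hxy hx
    have hy := hSi x y hxy hx
    apply hei
    apply le_antisymm
    · exact (hsp x hx).2 _ (hsp y hy).1 (hE.trans hxy (hsE y))
    · exact (hsp y hy).2 _ (hsp x hx).1 (hE.trans (hE.symm hxy) (hsE x))
  let Q : ℕ → X → Prop := fun m x => x ∈ S →
    (g m (s x) ∈ Y ∧ (∀ l, l < m → g l (s x) ≠ g m (s x)) ∧ ∃ i, i ≤ m ∧ g i (s x) = x)
  have hQex : ∀ x, ∃ m, Q m x := by
    intro x
    obtain ⟨i, hi⟩ := (hgE (s x) x).1 (hE.symm (hsE x))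
    let I : Set ℕ := {m | g m (s x) ∈ Y ∧ ∀ l, l < m → g l (s x) ≠ g m (s x)}
    have hI : I.Infinite := by
      intro hfin
      refine hYsec (s x) ((hfin.image fun m => g m (s x)).subset ?_)
      rintro y ⟨hy, hxy⟩
      have hex := (hgE _ _).1 hxy
      have h1 := Nat.find_spec hex
      refine ⟨Nat.find hex, ⟨by rw [h1]; exact hy, fun l hl => ?_⟩, h1⟩
      rw [h1]
      exact Nat.find_min hex hl
    obtain ⟨m, hm, hmi⟩ := hI.exists_gt i
    exact ⟨m, fun _ => ⟨hm.1, hm.2, i, hmi.le, hi⟩⟩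
  have hgs : ∀ i, Measurable fun x => g i (s x) := fun i => (hg i).comp hsm
  have hQm : ∀ m, MeasurableSet {x | Q m x} := by
    intro m
    refine MeasurableSet.imp hS (MeasurableSet.inter (hgs m hY) (MeasurableSet.inter ?_ ?_))
    · refine (MeasurableSet.iInter fun l : ℕ => MeasurableSet.imp (MeasurableSet.const (l < m))
        (measurableSet_eq_fun (hgs l) (hgs m)).compl).congr ?_
      ext x; simp; exact Iff.rfl
    · refine (MeasurableSet.iUnion fun i : ℕ => MeasurableSet.inter (MeasurableSet.const (i ≤ m))
        (measurableSet_eq_fun (hgs i) measurable_id)).congr ?_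
      ext x; simp; exact Iff.rfl
  let M : X → ℕ := fun x => Nat.find (hQex x)
  have hM : ∀ x, Q (M x) x := fun x => Nat.find_spec (hQex x)
  let F : X → X := fun x => if x ∈ S then g (M x) (s x) else f x
  have hFm : Measurable F := Measurable.ite hS (Measurable.find hgs hQm hQex)
    (measurable_subtype_coe.comp hf)
  have hFY : ∀ x, F x ∈ Y := by
    intro x
    by_cases hx : x ∈ S
    · simp only [F, if_pos hx]; exact (hM x hx).1
    · simp only [F, if_neg hx]; exact (f x).2
  refine ⟨fun x => ⟨F x, hFY x⟩, hFm.subtype_mk, ?_, ?_⟩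
  · intro x
    show E x (F x)
    by_cases hx : x ∈ S
    · simp only [F, if_pos hx]; exact hE.trans (hsE x) (hEg _ _)
    · simp only [F, if_neg hx]; exact hfE x
  · intro x hx y
    by_cases hne : {z | E x z ∧ (⟨F z, hFY z⟩ : Y) = y}.Nonempty
    · obtain ⟨z0, hz0, hz0y⟩ := hne
      refine ((Set.finite_Iic (M z0)).image fun i => g i (s x)).subset ?_
      rintro z ⟨hz, hzy⟩
      have hzS := hSi x z hz hx
      have hz0S := hSi x z0 hz0 hx
      have hFF : F z = F z0 := congrArg Subtype.val (hzy.trans hz0y.symm)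
      simp only [F, if_pos hzS, if_pos hz0S, ← hsinv x z hz hx, ← hsinv x z0 hz0 hx] at hFF
      obtain ⟨-, h1, i, hi, hi'⟩ := hM z hzS
      obtain ⟨-, h2, -⟩ := hM z0 hz0S
      rw [← hsinv x z hz hx] at h1 hi'
      rw [← hsinv x z0 hz0 hx] at h2
      have hMM : M z = M z0 := by
        rcases lt_trichotomy (M z) (M z0) with h | h | h
        · exact absurd hFF (h2 _ h)
        · exact h
        · exact absurd hFF.symm (h1 _ h)
      exact ⟨i, by simpa [← hMM] using hi, hi'⟩
    · rw [Set.not_nonempty_iff_eq_empty.1 hne]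
      exact Set.finite_empty

end LN

/-- If `E →_B (E)^n_k` holds, then for every Borel infinite complete section `Y`,
the strong Borel Ramsey property holds for the restriction `F = E ↾ Y`. -/
theorem strong_borel_ramsey_restrict_complete_section {X : Type*} [MeasurableSpace X] [StandardBorelSpace X]
    (E : X → X → Prop) (hE : Equivalence E)
    (hEBorel : MeasurableSet {p : X × X | E p.1 p.2})
    (hcount : ∀ x : X, {y | E x y}.Countable)
    (haper : ∀ x : X, {y | E x y}.Infinite)
    (n k : ℕ) (hn : 1 < n) (hk : 1 < k)
    (hRamsey : StrongBorelRamsey E n k)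
    (Y : Set X) (hY : MeasurableSet Y) (hYsec : IsInfiniteCompleteSection E Y) :
    StrongBorelRamsey (fun a b : Y => E a b) n k := by
  intro c hc
  obtain ⟨g, hg, hgE⟩ := LN.enum E hE hEBorel hcount
  have hEg : ∀ i x, E x (g i x) := fun i x => (hgE x _).2 ⟨i, rfl⟩
  have hex0 : ∀ x, ∃ i, g i x ∈ Y := by
    intro x
    obtain ⟨y, hy, hxy⟩ := (hYsec x).nonempty
    obtain ⟨i, rfl⟩ := (hgE x y).1 hxy
    exact ⟨i, hy⟩
  let f : X → Y := fun x => ⟨g (Nat.find (hex0 x)) x, Nat.find_spec (hex0 x)⟩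
  have hf : Measurable f := (Measurable.find hg (fun i => hg i hY) hex0).subtype_mk
  have hfE : ∀ x, E x (f x) := fun x => hEg _ x
  have himg : ∀ (f : X → Y), Measurable f → (∀ x, E x (f x)) → ∀ Z : Set X, MeasurableSet Z →
      MeasurableSet (f '' Z) := by
    intro f hf hfE Z hZ
    have : f '' Z = ⋃ i, {y : Y | g i y ∈ Z} ∩ {y : Y | f (g i y) = y} := by
      ext y
      simp only [Set.mem_image, Set.mem_iUnion]
      constructor
      · rintro ⟨z, hz, rfl⟩
        obtain ⟨i, hi⟩ := (hgE _ _).1 (hE.symm (hfE z))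
        refine ⟨i, ?_, ?_⟩
        · show g i (f z) ∈ Z
          rwa [hi]
        · show f (g i (f z)) = f z
          rw [hi]
      · rintro ⟨i, h1, h2⟩
        exact ⟨_, h1, h2⟩
    rw [this]
    have : StandardBorelSpace Y := hY.standardBorel
    refine MeasurableSet.iUnion fun i => ?_
    have hgi : Measurable fun y : Y => g i y := (hg i).comp measurable_subtype_coe
    exact (hgi hZ).inter (measurableSet_eq_fun (hf.comp hgi) measurable_id)
  obtain ⟨Z1, hZ1, hZ1i, hZ1m⟩ := LN.ram E hE n k hRamsey Y f hf hfE c hc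
  have hV1 := himg f hf hfE Z1 hZ1
  set V1 := f '' Z1 with hV1def
  let V : Set X := Subtype.val '' V1
  have hV : MeasurableSet V := hY.subtype_image hV1
  let S : Set X := {x | {y | y ∈ V ∧ E x y}.Finite}
  have hSi : ∀ x y, E x y → x ∈ S → y ∈ S := by
    intro x y hxy hx
    refine Set.Finite.subset hx ?_
    rintro z ⟨hz, hyz⟩
    exact ⟨hz, hE.trans hxy hyz⟩
  have hS : MeasurableSet S := by
    have : S = ⋃ N : ℕ, ⋂ i : ℕ, {x | g i x ∈ V → ∃ j : Fin N, g j x = g i x} := by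
      ext x
      simp only [Set.mem_iUnion, Set.mem_iInter]
      constructor
      · intro hx
        have hx : {y | y ∈ V ∧ E x y}.Finite := hx
        have h1 : ∀ y, ∃ j, E x y → g j x = y := by
          intro y
          by_cases h : E x y
          · obtain ⟨j, hj⟩ := (hgE x y).1 h
            exact ⟨j, fun _ => hj⟩
          · exact ⟨0, fun h' => absurd h' h⟩
        choose r hr using h1
        obtain ⟨N, hN⟩ := (hx.image r).bddAbove
        refine ⟨N + 1, fun i hi => ⟨⟨r (g i x), ?_⟩, hr _ (hEg i x)⟩⟩
        exact Nat.lt_succ_of_le (hN ⟨_, ⟨hi, hEg i x⟩, rfl⟩)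
      · rintro ⟨N, hN⟩
        refine (Set.finite_range fun j : Fin N => g j x).subset ?_
        rintro y ⟨hy, hxy⟩
        obtain ⟨i, rfl⟩ := (hgE x y).1 hxy
        exact hN i hy
    rw [this]
    refine MeasurableSet.iUnion fun N => MeasurableSet.iInter fun i =>
      MeasurableSet.imp (hg i hV) ?_
    refine (MeasurableSet.iUnion fun j : Fin N => measurableSet_eq_fun (hg j) (hg i)).congr ?_
    ext x; simp
  obtain ⟨f', hf', hf'E, hfin⟩ := LN.smooth_part E hE g hg hgE Y hY hYsec f hf hfE V S hV hS
    (fun x hx => hx) (by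
      intro x
      obtain ⟨z, hz, hxz⟩ := (hZ1i x).nonempty
      exact ⟨f z, ⟨f z, ⟨z, hz, rfl⟩, rfl⟩, hE.trans hxz (hfE z)⟩) hSi
  obtain ⟨Z2, hZ2, hZ2i, hZ2m⟩ := LN.ram E hE n k hRamsey Y f' hf' hf'E c hc
  have hV2 := himg f' hf' hf'E Z2 hZ2
  have hSY : MeasurableSet {y : Y | (y : X) ∈ S} := measurable_subtype_coe hS
  refine ⟨({y : Y | (y : X) ∈ S}ᶜ ∩ V1) ∪ ({y : Y | (y : X) ∈ S} ∩ f' '' Z2),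
    (hSY.compl.inter hV1).union (hSY.inter hV2), ?_, ?_⟩
  · intro y
    by_cases hy : (y : X) ∈ S
    · intro hfi
      refine hZ2i y ((hfi.biUnion fun b _ => hfin y hy b).subset ?_)
      rintro z ⟨hz, hyz⟩
      have hyf : E y (f' z) := hE.trans hyz (hf'E z)
      exact Set.mem_biUnion (x := f' z) ⟨Or.inr ⟨hSi y _ hyf hy, z, hz, rfl⟩, hyf⟩ ⟨hyz, rfl⟩
    · intro hfi
      apply hy
      refine (hfi.image Subtype.val).subset ?_
      rintro _ ⟨⟨t, ht, rfl⟩, hyt⟩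
      exact ⟨t, ⟨Or.inl ⟨fun h => hy (hSi _ _ (hE.symm hyt) h), ht⟩, hyt⟩, rfl⟩
  · intro y
    by_cases hy : (y : X) ∈ S
    · obtain ⟨a, ha⟩ := hZ2m y
      refine ⟨a, fun A hA hAs hAE => ha A hA ?_ hAE⟩
      intro t ht
      rcases hAs ht with h | h
      · exact absurd (hSi _ _ (hAE t ht) hy) h.1
      · exact h.2
    · obtain ⟨a, ha⟩ := hZ1m y
      refine ⟨a, fun A hA hAs hAE => ha A hA ?_ hAE⟩
      intro t ht
      rcases hAs ht with h | h
      · exact h.2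
      · exact absurd (hSi _ _ (hE.symm (hAE t ht)) h.1) hy
end
end

section
/- Let X be a standard Borel space, let E be an aperiodic, countable Borel equivalence relation on X, and let n, k > 1 be integers. Let Y ⊆ X be a Borel set and let F be the restriction of E to Y. Assume F is aperiodic. If the strong Borel Ramsey property E →_B (E)^n_k holds, then the strong Borel Ramsey property F →_B (F)^n_k holds. -/
open Classical

noncomputable section

section LusinNovikov
open MeasureTheory Set Filter Topology

/-- Analyticity of the set of points sharing their image with another point of an analytic set. -/
theorem aux_nbr_analytic {F X : Type*} [TopologicalSpace F] [PolishSpace F] [MeasurableSpace F]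
    [BorelSpace F] [MeasurableSpace X] [MeasurableEq X] {g : F → X} (hg : Measurable g)
    {C : Set F} (hC : AnalyticSet C) :
    AnalyticSet {z | ∃ z' ∈ C, z' ≠ z ∧ g z' = g z} := by
  have h1 : AnalyticSet (Prod.fst ⁻¹' C : Set (F × F)) := hC.preimage continuous_fst
  have h2 : MeasurableSet {p : F × F | p.1 ≠ p.2 ∧ g p.1 = g p.2} := by
    apply MeasurableSet.inter
    · exact (measurableSet_eq_fun measurable_fst measurable_snd).compl
    · exact measurableSet_eq_fun (hg.comp measurable_fst) (hg.comp measurable_snd)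
  have h3 : AnalyticSet ((Prod.fst ⁻¹' C) ∩ {p : F × F | p.1 ≠ p.2 ∧ g p.1 = g p.2}) := by
    rw [Set.inter_eq_iInter]
    apply AnalyticSet.iInter
    rintro (_ | _)
    · exact h2.analyticSet
    · exact h1
  convert h3.image_of_continuous continuous_snd using 1
  ext z
  simp only [mem_ofPred_eq, mem_image, mem_inter_iff, mem_preimage, Prod.exists]
  constructor
  · rintro ⟨z', h, h'⟩
    exact ⟨z', z, ⟨h, h'⟩, rfl⟩
  · rintro ⟨a, b, ⟨h, h'⟩, rfl⟩
    exact ⟨a, h, h'⟩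

/-- Reflection: an analytic set on which `g` is injective is contained in a Borel such set. -/
theorem aux_reflect {F X : Type*} [TopologicalSpace F] [PolishSpace F] [MeasurableSpace F]
    [BorelSpace F] [MeasurableSpace X] [MeasurableEq X] {g : F → X} (hg : Measurable g)
    {A : Set F} (hA : AnalyticSet A) (hinj : InjOn g A) :
    ∃ D, A ⊆ D ∧ MeasurableSet D ∧ InjOn g D := by
  obtain ⟨u, hu1, hu2, hu3⟩ := hA.measurablySeparable (aux_nbr_analytic hg hA) (by
    rw [Set.disjoint_left]
    rintro z hz ⟨z', hz', h1, h2⟩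
    exact h1 (hinj hz' hz h2))
  obtain ⟨v, hv1, hv2, hv3⟩ := hA.measurablySeparable (aux_nbr_analytic hg hu3.analyticSet) (by
    rw [Set.disjoint_left]
    rintro z hz ⟨z', hz', h1, h2⟩
    exact Set.disjoint_left.1 hu2 ⟨z, hz, h1.symm, h2.symm⟩ hz')
  refine ⟨u ∩ v, subset_inter hu1 hv1, hu3.inter hv3, ?_⟩
  rintro z hz z' hz' h
  by_contra hne
  exact Set.disjoint_left.1 hv2 ⟨z, hz.1, hne, h⟩ hz'.2

/-- If `F` is not a countable union of Borel `g`-injective sets, there is a Borel nonempty `B` all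
of whose configurations persist when removing Borel `g`-injective sets. -/
theorem aux_core {F X : Type*} [MetricSpace F] [SecondCountableTopology F] [MeasurableSpace F]
    [BorelSpace F] [MeasurableSpace X] (g : F → X)
    (hns : ¬ ∃ B : ℕ → Set F, (∀ n, MeasurableSet (B n)) ∧ (∀ n, InjOn g (B n)) ∧
      ⋃ n, B n = univ) :
    ∃ B : Set F, MeasurableSet B ∧ B.Nonempty ∧
      ∀ (m : ℕ) (z : ℕ → F) (ε : ℝ) (D : Set F), 0 < ε → (∀ i ≤ m, z i ∈ B) →
        (∀ i ≤ m, g (z i) = g (z 0)) → MeasurableSet D → InjOn g D →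
        ∃ z' : ℕ → F, (∀ i ≤ m, z' i ∈ B ∧ z' i ∉ D ∧ dist (z' i) (z i) < ε) ∧
          ∀ i ≤ m, g (z' i) = g (z' 0) := by
  let Cov : Set F → Prop := fun A => ∃ D : ℕ → Set F, (∀ n, MeasurableSet (D n)) ∧
    (∀ n, InjOn g (D n)) ∧ A ⊆ ⋃ n, D n
  let Cfg : (Σ m : ℕ, (Fin (m+1) → TopologicalSpace.countableBasis F)) → Set F → Prop :=
    fun a B => ∃ z : ℕ → F, (∀ i : Fin (a.1+1), z i ∈ B ∧ z i ∈ (a.2 i : Set F)) ∧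
      ∀ i ≤ a.1, g (z i) = g (z 0)
  have cov_union : ∀ {ι : Type} [Countable ι] (A : ι → Set F), (∀ i, Cov (A i)) →
      Cov (⋃ i, A i) := by
    intro ι _ A h
    rcases isEmpty_or_nonempty ι with he | he
    · exact ⟨fun _ => ∅, fun _ => MeasurableSet.empty, fun _ => injOn_empty _, by simp⟩
    choose D h1 h2 h3 using h
    obtain ⟨e, he⟩ := exists_surjective_nat (ι × ℕ)
    refine ⟨fun n => D (e n).1 (e n).2, fun n => h1 _ _, fun n => h2 _ _, ?_⟩
    intro x hx
    obtain ⟨i, hi⟩ := mem_iUnion.1 hx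
    obtain ⟨j, hj⟩ := mem_iUnion.1 (h3 i hi)
    obtain ⟨n, hn⟩ := he (i, j)
    exact mem_iUnion.2 ⟨n, by rw [hn]; exact hj⟩
  have key : ∀ a, ∃ B : Set F, MeasurableSet B ∧ Cov Bᶜ ∧
      (Cfg a B → ∀ B', MeasurableSet B' → Cov B'ᶜ → Cfg a B') := by
    intro a
    by_cases h : ∀ B', MeasurableSet B' → Cov B'ᶜ → Cfg a B'
    · exact ⟨univ, MeasurableSet.univ,
        ⟨fun _ => ∅, fun _ => MeasurableSet.empty, fun _ => injOn_empty _, by simp⟩, fun _ => h⟩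
    · push Not at h
      obtain ⟨B', h1, h2, h3⟩ := h
      exact ⟨B', h1, h2, fun h => absurd h h3⟩
  choose Bs hB1 hB2 hB3 using key
  have hcountA : Countable (Σ m : ℕ, (Fin (m+1) → TopologicalSpace.countableBasis F)) := by
    have : Countable (TopologicalSpace.countableBasis F) :=
      (TopologicalSpace.countable_countableBasis F).to_subtype
    infer_instance
  have hBm : MeasurableSet (⋂ a, Bs a) := MeasurableSet.iInter hB1
  have hBc : Cov (⋂ a, Bs a)ᶜ := by
    rw [compl_iInter]
    have : Nonempty (Option (Σ m : ℕ, (Fin (m+1) → TopologicalSpace.countableBasis F))) := ⟨none⟩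
    obtain ⟨e, he⟩ := exists_surjective_nat
      (Option (Σ m : ℕ, (Fin (m+1) → TopologicalSpace.countableBasis F)))
    have := cov_union (fun n : ℕ => match e n with
      | none => ∅
      | some a => (Bs a)ᶜ) (by
        intro n
        rcases h : e n with _ | a
        · simp only
          exact ⟨fun _ => ∅, fun _ => MeasurableSet.empty, fun _ => injOn_empty _, by simp⟩
        · simp only
          exact hB2 a)
    obtain ⟨D, h1, h2, h3⟩ := this
    refine ⟨D, h1, h2, Subset.trans ?_ h3⟩
    intro x hx
    obtain ⟨a, ha⟩ := mem_iUnion.1 hx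
    obtain ⟨n, hn⟩ := he (some a)
    exact mem_iUnion.2 ⟨n, by simp only [hn]; exact ha⟩
  refine ⟨⋂ a, Bs a, hBm, ?_, ?_⟩
  · by_contra hne
    rw [not_nonempty_iff_eq_empty] at hne
    rw [hne, compl_empty] at hBc
    obtain ⟨D, h1, h2, h3⟩ := hBc
    exact hns ⟨D, h1, h2, univ_subset_iff.1 h3⟩
  · intro m z ε D hε hzB hzg hD hDi
    have : ∀ i : Fin (m+1), ∃ u : TopologicalSpace.countableBasis F, z i ∈ (u : Set F) ∧
        (u : Set F) ⊆ Metric.ball (z i) ε := by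
      intro i
      obtain ⟨u, hu, h1, h2⟩ := (TopologicalSpace.isBasis_countableBasis F).mem_nhds_iff.1
        (Metric.ball_mem_nhds (z i) hε)
      exact ⟨⟨u, hu⟩, h1, h2⟩
    choose u hu1 hu2 using this
    have hc : Cfg ⟨m, u⟩ (Bs ⟨m, u⟩) := by
      refine ⟨z, fun i => ⟨?_, hu1 i⟩, hzg⟩
      exact mem_iInter.1 (hzB i (Nat.lt_succ_iff.1 i.2)) _
    obtain ⟨z', h1, h2⟩ := hB3 _ hc ((⋂ a, Bs a) \ D) (hBm.diff hD) (by
      have := cov_union (fun b : Bool => if b then (⋂ a, Bs a)ᶜ else D) (by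
        rintro (_ | _)
        · simp only [Bool.false_eq_true, if_false]
          exact ⟨fun _ => D, fun _ => hD, fun _ => hDi, fun x hx => mem_iUnion.2 ⟨0, hx⟩⟩
        · simpa using hBc)
      obtain ⟨D', g1, g2, g3⟩ := this
      refine ⟨D', g1, g2, Subset.trans ?_ g3⟩
      intro x hx
      by_cases hxD : x ∈ D
      · exact mem_iUnion.2 ⟨false, by simpa using hxD⟩
      · refine mem_iUnion.2 ⟨true, ?_⟩
        simp only [if_true]
        exact fun h => hx ⟨h, hxD⟩)
    refine ⟨z', fun i hi => ?_, h2⟩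
    have := h1 ⟨i, Nat.lt_succ_iff.2 hi⟩
    exact ⟨this.1.1, this.1.2, hu2 ⟨i, Nat.lt_succ_iff.2 hi⟩ this.2⟩

/-- One splitting step. -/
theorem aux_step {F X : Type*} [MetricSpace F] [CompleteSpace F] [SecondCountableTopology F]
    [MeasurableSpace F]
    [BorelSpace F] [MeasurableSpace X] [MeasurableEq X] {g : F → X} (hg : Measurable g)
    {B : Set F} (hB : MeasurableSet B)
    (hBp : ∀ (m : ℕ) (z : ℕ → F) (ε : ℝ) (D : Set F), 0 < ε → (∀ i ≤ m, z i ∈ B) →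
        (∀ i ≤ m, g (z i) = g (z 0)) → MeasurableSet D → InjOn g D →
        ∃ z' : ℕ → F, (∀ i ≤ m, z' i ∈ B ∧ z' i ∉ D ∧ dist (z' i) (z i) < ε) ∧
          ∀ i ≤ m, g (z' i) = g (z' 0))
    (m : ℕ) (z : ℕ → F) (ε : ℝ) (hε : 0 < ε) (hzB : ∀ i ≤ m, z i ∈ B)
    (hzg : ∀ i ≤ m, g (z i) = g (z 0)) (p : ℕ) (hp : p ≤ m) :
    ∃ z' : ℕ → F, (∀ i ≤ m+1, z' i ∈ B) ∧ (∀ i ≤ m+1, g (z' i) = g (z' 0)) ∧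
      (∀ i ≤ m, dist (z' i) (z i) < ε) ∧ dist (z' (m+1)) (z p) < ε ∧ z' (m+1) ≠ z' p := by
  let K : Set (ℕ → F) := {w | (∀ i ≤ m, w i ∈ B ∧ dist (w i) (z i) < ε) ∧
    ∀ i ≤ m, g (w i) = g (w 0)}
  have hK : MeasurableSet K := by
    apply MeasurableSet.inter
    · have : {w : ℕ → F | ∀ i ≤ m, w i ∈ B ∧ dist (w i) (z i) < ε} =
          ⋂ i, ⋂ (_ : i ≤ m), {w : ℕ → F | w i ∈ B ∧ dist (w i) (z i) < ε} := by
        ext; simp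
      change MeasurableSet {w : ℕ → F | ∀ i ≤ m, w i ∈ B ∧ dist (w i) (z i) < ε}
      rw [this]
      refine MeasurableSet.iInter fun i => MeasurableSet.iInter fun _ => ?_
      have hm := hB.inter (Metric.isOpen_ball (x := z i) (ε := ε)).measurableSet
      exact measurable_pi_apply (X := fun _ : ℕ => F) i hm
    · have : {w : ℕ → F | ∀ i ≤ m, g (w i) = g (w 0)} =
          ⋂ i, ⋂ (_ : i ≤ m), {w : ℕ → F | g (w i) = g (w 0)} := by
        ext; simp
      change MeasurableSet {w : ℕ → F | ∀ i ≤ m, g (w i) = g (w 0)}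
      rw [this]
      refine MeasurableSet.iInter fun i => MeasurableSet.iInter fun _ => ?_
      exact measurableSet_eq_fun (hg.comp (measurable_pi_apply i))
        (hg.comp (measurable_pi_apply 0))
  have hA : AnalyticSet ((fun w : ℕ → F => w p) '' K) :=
    hK.analyticSet.image_of_continuous (continuous_apply p)
  by_cases hinj : InjOn g ((fun w : ℕ → F => w p) '' K)
  · exfalso
    obtain ⟨D, hD1, hD2, hD3⟩ := aux_reflect hg hA hinj
    obtain ⟨w, h1, h2⟩ := hBp m z ε D hε hzB hzg hD2 hD3
    exact (h1 p hp).2.1 (hD1 ⟨w, ⟨fun i hi => ⟨(h1 i hi).1, (h1 i hi).2.2⟩, h2⟩, rfl⟩)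
  · simp only [InjOn] at hinj
    push Not at hinj
    obtain ⟨_, ⟨w, hw, rfl⟩, _, ⟨w', hw', rfl⟩, h1, h2⟩ := hinj
    simp only at h1 h2
    have e : ∀ i ≤ m, (fun i => if i = m+1 then w' p else w i) i = w i := by
      intro i hi
      have : i ≠ m + 1 := by omega
      simp [this]
    refine ⟨fun i => if i = m+1 then w' p else w i, ?_, ?_, ?_, ?_, ?_⟩
    · intro i hi
      rcases Nat.le_succ_iff.1 hi with h | h
      · rw [e i h]; exact (hw.1 i h).1
      · simp only [h]; simpa using (hw'.1 p hp).1
    · intro i hi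
      rw [e 0 (Nat.zero_le _)]
      rcases Nat.le_succ_iff.1 hi with h | h
      · rw [e i h]; exact (hw.2 i h)
      · simp only [h, if_true]
        rw [← h1]; exact hw.2 p hp
    · intro i hi
      rw [e i hi]; exact (hw.1 i hi).2
    · simpa using (hw'.1 p hp).2
    · rw [e p hp]
      simpa using h2.symm

/-- Lusin–Novikov in a complete metric space, for continuous countable-to-one maps. -/
theorem aux_LN_metric {F X : Type*} [MetricSpace F] [CompleteSpace F] [SecondCountableTopology F]
    [MeasurableSpace F] [BorelSpace F] [TopologicalSpace X] [T2Space X] [MeasurableSpace X]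
    [MeasurableEq X] {g : F → X} (hg : Measurable g) (hgc : Continuous g)
    (hcount : ∀ x, (g ⁻¹' {x}).Countable) :
    ∃ B : ℕ → Set F, (∀ n, MeasurableSet (B n)) ∧ (∀ n, InjOn g (B n)) ∧ ⋃ n, B n = univ := by
  by_contra hns
  obtain ⟨B, hB, ⟨b, hb⟩, hBp⟩ := aux_core g hns
  let St : ℕ → Type _ := fun m => {s : (ℕ → F) × ℝ // 0 < s.2 ∧ (∀ i ≤ m, s.1 i ∈ B) ∧
    ∀ i ≤ m, g (s.1 i) = g (s.1 0)}
  have step : ∀ m (s : St m), ∃ s' : St (m+1), (∀ i ≤ m, dist (s'.1.1 i) (s.1.1 i) < s.1.2) ∧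
      dist (s'.1.1 (m+1)) (s.1.1 (Nat.unpair m).1) < s.1.2 ∧
      s'.1.2 ≤ s.1.2 / 2 ∧ 0 < dist (s'.1.1 (m+1)) (s'.1.1 (Nat.unpair m).1) ∧
      s'.1.2 ≤ dist (s'.1.1 (m+1)) (s'.1.1 (Nat.unpair m).1) / 8 := by
    rintro m ⟨⟨z, ε⟩, hε, h1, h2⟩
    obtain ⟨z', g1, g2, g3, g4, g5⟩ := aux_step hg hB hBp m z ε hε h1 h2 (Nat.unpair m).1
      (Nat.unpair_left_le m)
    have hpos := dist_pos.2 g5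
    exact ⟨⟨(z', min (ε/2) (dist (z' (m+1)) (z' (Nat.unpair m).1) / 8)),
      lt_min (half_pos hε) (by positivity), g1, g2⟩, g3, g4, min_le_left _ _, hpos,
      min_le_right _ _⟩
  choose nx hx1 hx2 hx3 hx4 hx5 using step
  let S : ∀ m, St m := fun m => Nat.rec (motive := St)
    ⟨(fun _ => b, 1), one_pos, fun _ _ => hb, fun _ _ => rfl⟩ (fun m s => nx m s) m
  have hS : ∀ m, S (m+1) = nx m (S m) := fun m => rfl
  let Z : ℕ → ℕ → F := fun m => (S m).1.1
  let e : ℕ → ℝ := fun m => (S m).1.2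
  have he0 : ∀ m, 0 < e m := fun m => (S m).2.1
  have hg0 : ∀ m, ∀ i ≤ m, g (Z m i) = g (Z m 0) := fun m => (S m).2.2.2
  have h1 : ∀ m, ∀ i ≤ m, dist (Z (m+1) i) (Z m i) < e m := fun m => hx1 m (S m)
  have h2 : ∀ m, dist (Z (m+1) (m+1)) (Z m (Nat.unpair m).1) < e m := fun m => hx2 m (S m)
  have h3 : ∀ m, e (m+1) ≤ e m / 2 := fun m => hx3 m (S m)
  have h4 : ∀ m, 0 < dist (Z (m+1) (m+1)) (Z (m+1) (Nat.unpair m).1) := fun m => hx4 m (S m)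
  have h5 : ∀ m, e (m+1) ≤ dist (Z (m+1) (m+1)) (Z (m+1) (Nat.unpair m).1) / 8 :=
    fun m => hx5 m (S m)
  clear_value Z e
  clear hS S hx1 hx2 hx3 hx4 hx5 nx St
  have he2 : ∀ m l, e (m + l) ≤ 2 * e m / 2 / 2 ^ l := by
    intro m l
    induction l with
    | zero => simp
    | succ l ih =>
      have := h3 (m + l)
      rw [← add_assoc, pow_succ, ← div_div]
      linarith
  have hd : ∀ m i, i ≤ m → ∀ l, dist (Z (m+l) i) (Z (m+(l+1)) i) ≤ 2 * e m / 2 / 2 ^ l := by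
    intro m i hi l
    rw [dist_comm]
    exact (h1 (m+l) i (by omega)).le.trans (he2 m l)
  have hlim : ∀ i, ∃ w, Tendsto (fun m => Z m i) atTop (𝓝 w) := by
    intro i
    obtain ⟨w, hw⟩ := cauchySeq_tendsto_of_complete
      (cauchySeq_of_le_geometric_two (hd i i le_rfl))
    refine ⟨w, (tendsto_add_atTop_iff_nat i).1 ?_⟩
    simpa [add_comm] using hw
  choose w hw using hlim
  have hwd : ∀ m i, i ≤ m → dist (Z m i) (w i) ≤ 2 * e m := by
    intro m i hi
    have := dist_le_of_le_geometric_two_of_tendsto₀ (hd m i hi) (a := w i) (by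
      have := (tendsto_add_atTop_iff_nat m).2 (hw i)
      simpa [add_comm] using this)
    simpa using this
  have hgw : ∀ i, g (w i) = g (w 0) := by
    intro i
    refine tendsto_nhds_unique ((hgc.tendsto _).comp (hw i)) ?_
    refine ((hgc.tendsto _).comp (hw 0)).congr' ?_
    filter_upwards [eventually_ge_atTop i] with m hm
    exact (hg0 m i hm).symm
  have he_lim : ∀ δ > 0, ∃ N, ∀ m ≥ N, e m < δ := by
    intro δ hδ
    have : Tendsto (fun l : ℕ => e 0 * (1/2 : ℝ) ^ l) atTop (𝓝 (e 0 * 0)) :=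
      (tendsto_pow_atTop_nhds_zero_of_lt_one (by norm_num) (by norm_num)).const_mul _
    rw [mul_zero] at this
    obtain ⟨N, hN⟩ := eventually_atTop.1 (this.eventually_lt_const hδ)
    refine ⟨N, fun m hm => lt_of_le_of_lt ?_ (hN m hm)⟩
    have := he2 0 m
    rw [zero_add] at this
    refine this.trans_eq ?_
    rw [one_div, inv_pow]; field_simp
  have hpre : Preperfect (range w) := by
    rw [preperfect_iff_nhds]
    rintro _ ⟨i, rfl⟩ U hU
    obtain ⟨δ, hδ, hball⟩ := Metric.mem_nhds_iff.1 hU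
    obtain ⟨N, hN⟩ := he_lim (δ/8) (by positivity)
    have hm : N ≤ Nat.pair i N := Nat.right_le_pair _ _
    have hi : (Nat.unpair (Nat.pair i N)).1 = i := by simp
    have him : i ≤ Nat.pair i N := Nat.left_le_pair _ _
    generalize Nat.pair i N = m at hm hi him
    have a1 := hwd (m+1) (m+1) le_rfl
    have a2 := hwd m i him
    have a2' := hwd (m+1) i (by omega)
    have a3 := h2 m
    have a4 := h5 m
    have a6 := h4 m
    have a5 := h3 m
    have a7 := hN m hm
    rw [hi] at a3 a4 a6
    refine ⟨w (m+1), ⟨hball ?_, m+1, rfl⟩, ?_⟩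
    · rw [Metric.mem_ball]
      have := dist_triangle4 (w (m+1)) (Z (m+1) (m+1)) (Z m i) (w i)
      rw [dist_comm (w (m+1))] at this
      rw [dist_comm (w (m+1))] at this ⊢
      rw [dist_comm] at this
      have := he0 m
      rw [dist_comm]
      linarith
    · intro heq
      have := dist_triangle (Z (m+1) (m+1)) (w (m+1)) (Z (m+1) i)
      rw [heq] at this a1
      rw [dist_comm (w i) (Z (m+1) i)] at this
      linarith
  obtain ⟨f, hf1, -, hf3⟩ := hpre.perfect_closure.exists_nat_bool_injection
    ⟨w 0, subset_closure ⟨0, rfl⟩⟩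
  have hsub : closure (range w) ⊆ g ⁻¹' {g (w 0)} := by
    refine closure_minimal ?_ (isClosed_singleton.preimage hgc)
    rintro _ ⟨i, rfl⟩
    exact hgw i
  have hc : (range f).Countable := (hcount _).mono (hf1.trans hsub)
  have : Countable (ℕ → Bool) := by
    have := hc.to_subtype
    exact (rangeFactorization_injective.2 hf3).countable
  obtain ⟨q, hq⟩ := exists_surjective_nat (ℕ → Bool)
  obtain ⟨n, hn⟩ := hq (fun n => !(q n n))
  have := congrFun hn n
  simp at this

/-- Lusin–Novikov for countable-to-one maps between standard Borel spaces. -/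
theorem aux_LN {F X : Type*} [MeasurableSpace F] [StandardBorelSpace F] [MeasurableSpace X]
    [StandardBorelSpace X] {g : F → X} (hg : Measurable g)
    (hcount : ∀ x, (g ⁻¹' {x}).Countable) :
    ∃ B : ℕ → Set F, (∀ n, MeasurableSet (B n)) ∧ (∀ n, InjOn g (B n)) ∧ ⋃ n, B n = univ := by
  obtain ⟨tX, hbX, hpX⟩ := StandardBorelSpace.polish (α := X)
  obtain ⟨tF, hbF, hpF⟩ := StandardBorelSpace.polish (α := F)
  obtain ⟨t', ht, hc, hp'⟩ := hg.exists_continuous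
  have hb' : @BorelSpace F t' _ := by
    refine @BorelSpace.mk _ t' _ ?_
    rw [hbF.measurable_eq]
    exact (borel_eq_borel_of_le hp' hpF ht).symm
  clear ht hpF hbF tF
  let _ := @TopologicalSpace.upgradeIsCompletelyMetrizable F t' _
  exact aux_LN_metric hg hc hcount

end LusinNovikov

section RamseyHelpers
open MeasureTheory Set

/-- Borel enumeration of the classes of a countable Borel equivalence relation. -/
theorem aux_enum {X : Type*} [MeasurableSpace X] [StandardBorelSpace X]
    (E : X → X → Prop) (hE : Equivalence E)
    (hEBorel : MeasurableSet {p : X × X | E p.1 p.2})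
    (hcount : ∀ x : X, {y | E x y}.Countable) :
    ∃ h : ℕ → X → X, (∀ n, Measurable (h n)) ∧ ∀ x y, E x y ↔ ∃ n, h n x = y := by
  let P : Set (X × X) := {p : X × X | E p.1 p.2}
  have hP : StandardBorelSpace P := hEBorel.standardBorel
  let g : P → X := fun p => p.1.1
  have hg : Measurable g := measurable_fst.comp measurable_subtype_coe
  have hgc : ∀ x, (g ⁻¹' {x}).Countable := by
    intro x
    refine Set.MapsTo.countable_of_injOn (f := fun p : P => p.1.2) (t := {y | E x y}) ?_ ?_
      (hcount x)
    · rintro ⟨⟨a, b⟩, hab⟩ h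
      simp only [g, mem_preimage, mem_singleton_iff] at h
      subst h
      exact hab
    · rintro ⟨⟨a, b⟩, hab⟩ h ⟨⟨a', b'⟩, hab'⟩ h' heq
      simp only [g, mem_preimage, mem_singleton_iff] at h h' heq
      subst h; subst h'; subst heq; rfl
  obtain ⟨B, hB1, hB2, hB3⟩ := aux_LN hg hgc
  let h : ℕ → X → X := fun n x => if hx : ∃ p ∈ B n, g p = x then (Classical.choose hx).1.2 else x
  have hh1 : ∀ n (p : P), p ∈ B n → h n (g p) = p.1.2 := by
    intro n p hp
    have hx : ∃ p' ∈ B n, g p' = g p := ⟨p, hp, rfl⟩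
    have : Classical.choose hx = p :=
      hB2 n (Classical.choose_spec hx).1 hp (Classical.choose_spec hx).2
    simp only [h, dif_pos hx, this]
  have hh2 : ∀ n x, (¬ ∃ p ∈ B n, g p = x) → h n x = x := by
    intro n x hx
    simp only [h, dif_neg hx]
  clear_value h
  refine ⟨h, ?_, ?_⟩
  · intro n S hS
    have : h n ⁻¹' S = g '' (B n ∩ {p : P | p.1.2 ∈ S}) ∪ ((g '' B n)ᶜ ∩ S) := by
      ext x
      by_cases hx : ∃ p ∈ B n, g p = x
      · obtain ⟨p, hp, rfl⟩ := hx
        rw [mem_preimage, hh1 n p hp]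
        constructor
        · intro hs
          exact Or.inl ⟨p, ⟨hp, hs⟩, rfl⟩
        · rintro (⟨q, ⟨hq, hq'⟩, heq⟩ | ⟨hx, -⟩)
          · rw [← hB2 n hq hp heq]; exact hq'
          · exact absurd ⟨p, hp, rfl⟩ hx
      · rw [mem_preimage, hh2 n x hx]
        constructor
        · intro hs
          exact Or.inr ⟨hx, hs⟩
        · rintro (⟨q, ⟨hq, hq'⟩, heq⟩ | ⟨-, hs⟩)
          · exact absurd ⟨q, hq, heq⟩ hx
          · exact hs
    rw [this]
    have hm : MeasurableSet {p : P | p.1.2 ∈ S} :=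
      (measurable_snd.comp measurable_subtype_coe) hS
    exact (((hB1 n).inter hm).image_of_measurable_injOn hg
      ((hB2 n).mono inter_subset_left)).union
      (((hB1 n).image_of_measurable_injOn hg (hB2 n)).compl.inter hS)
  · intro x y
    constructor
    · intro hxy
      have : (⟨(x, y), hxy⟩ : P) ∈ ⋃ n, B n := by rw [hB3]; trivial
      obtain ⟨n, hn⟩ := mem_iUnion.1 this
      exact ⟨n, hh1 n _ hn⟩
    · rintro ⟨n, rfl⟩
      by_cases hx : ∃ p ∈ B n, g p = x
      · obtain ⟨p, hp, rfl⟩ := hx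
        rw [hh1 n p hp]
        exact p.2
      · rw [hh2 n x hx]
        exact hE.refl x

/-- Borel selection of the first index whose condition holds. -/
theorem aux_sel {X : Type*} [MeasurableSpace X] {g : ℕ → X → X} (hg : ∀ n, Measurable (g n))
    {R : ℕ → Set X} (hR : ∀ n, MeasurableSet (R n)) :
    ∃ f : X → X, Measurable f ∧
      ∀ x, (∃ n, x ∈ R n ∧ f x = g n x) ∨ ((∀ n, x ∉ R n) ∧ f x = x) := by
  have hN : MeasurableSet {x | ∀ m, x ∉ R m} := by
    have : {x | ∀ m, x ∉ R m} = ⋂ m, (R m)ᶜ := by ext; simp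
    rw [this]
    exact MeasurableSet.iInter fun m => (hR m).compl
  have hex : ∀ x, ∃ n, x ∈ R n ∨ ∀ m, x ∉ R m := by
    intro x
    by_cases h : ∃ n, x ∈ R n
    · exact ⟨h.choose, Or.inl h.choose_spec⟩
    · push Not at h
      exact ⟨0, Or.inr h⟩
  refine ⟨fun x => (fun n x => if x ∈ {x | ∀ m, x ∉ R m} then x else g n x) (Nat.find (hex x)) x,
    Measurable.find (p := fun n x => x ∈ R n ∨ ∀ m, x ∉ R m)
      (fun n => Measurable.ite hN measurable_id (hg n)) (fun n => (hR n).union hN) hex, ?_⟩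
  intro x
  by_cases h : ∀ m, x ∉ R m
  · refine Or.inr ⟨h, ?_⟩
    simp [h]
  · left
    have := Nat.find_spec (hex x)
    refine ⟨_, this.resolve_right h, ?_⟩
    simp only [mem_ofPred_eq, if_neg h]

/-- Pushing forward monochromatic sets along a Borel map inside the classes. -/
theorem aux_push {X : Type*} [MeasurableSpace X] [StandardBorelSpace X]
    (E : X → X → Prop) (hE : Equivalence E)
    (h : ℕ → X → X) (hh : ∀ n, Measurable (h n)) (hh' : ∀ x y, E x y ↔ ∃ n, h n x = y)
    (n k : ℕ) (hk : 1 < k) (Y : Set X) (hY : MeasurableSet Y)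
    (hRamsey : StrongBorelRamsey E n k)
    (c : Finset Y → Fin k) (hc : IsBorelColoring n c)
    (f : X → X) (hf : Measurable f) (hfE : ∀ x, E x (f x)) :
    ∃ Z : Set X, IsInfiniteCompleteSection E Z ∧ MeasurableSet {y : Y | ∃ z ∈ Z, f z = y} ∧
      IsMonochromatic (fun a b : Y => E a b) n c {y : Y | ∃ z ∈ Z, f z = y} := by
  let c1 : Finset X → Fin k := fun A =>
    if ∀ x ∈ A, f x ∈ Y then c ((A.image f).subtype (· ∈ Y)) else ⟨0, by omega⟩
  have hc1 : IsBorelColoring n c1 := by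
    let V : Set (Fin n → X) := {v | ∀ i, f (v i) ∈ Y}
    have hV : MeasurableSet V := by
      have : V = ⋂ i, {v : Fin n → X | f (v i) ∈ Y} := by ext; simp [V]
      rw [this]
      exact MeasurableSet.iInter fun i => (hf.comp (measurable_pi_apply i)) hY
    have hm1 : Measurable fun v : V => c (Set.finite_range
        (fun i => (⟨f (v.1 i), v.2 i⟩ : Y))).toFinset := by
      refine hc.comp (g := fun v : Fin n → Y => c (Set.finite_range v).toFinset)
        (f := fun v : V => fun i => (⟨f (v.1 i), v.2 i⟩ : Y)) ?_
      refine measurable_pi_lambda _ fun i => Measurable.subtype_mk ?_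
      exact hf.comp ((measurable_pi_apply i).comp measurable_subtype_coe)
    have hm2 := Measurable.dite (s := V) hm1
      (g := fun _ : (Vᶜ : Set (Fin n → X)) => (⟨0, by omega⟩ : Fin k)) measurable_const hV
    unfold IsBorelColoring
    convert hm2 using 1
    ext1 v
    by_cases hv : v ∈ V
    · have : ∀ x ∈ (Set.finite_range v).toFinset, f x ∈ Y := by
        intro x hx
        simp only [Set.Finite.mem_toFinset, mem_range] at hx
        obtain ⟨i, rfl⟩ := hx
        exact hv i
      simp only [c1, dif_pos hv, if_pos this]
      congr 1
      ext y
      simp [Subtype.ext_iff]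
    · have : ¬ ∀ x ∈ (Set.finite_range v).toFinset, f x ∈ Y := by
        intro hx
        exact hv fun i => hx _ (by simp)
      simp only [c1, dif_neg hv, if_neg this]
  obtain ⟨Z, hZ1, hZ2, hZ3⟩ := hRamsey c1 hc1
  refine ⟨Z, hZ2, ?_, ?_⟩
  · have : {y : Y | ∃ z ∈ Z, f z = y} =
        Subtype.val ⁻¹' (⋃ m, {x : X | h m x ∈ Z ∧ f (h m x) = x}) := by
      ext y
      simp only [mem_ofPred_eq, mem_preimage, mem_iUnion]
      constructor
      · rintro ⟨z, hz, hzy⟩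
        obtain ⟨m, hm⟩ := (hh' y z).1 (by rw [← hzy]; exact hE.symm (hfE z))
        exact ⟨m, by rw [hm]; exact ⟨hz, hzy⟩⟩
      · rintro ⟨m, hm⟩
        exact ⟨_, hm⟩
    rw [this]
    refine measurable_subtype_coe (MeasurableSet.iUnion fun m => ?_)
    exact (hh m hZ1).inter (measurableSet_eq_fun (hf.comp (hh m)) measurable_id)
  · intro y
    obtain ⟨a, ha⟩ := hZ3 y
    refine ⟨a, fun A hAn hAW hAE => ?_⟩
    have : ∀ y : Y, ∃ z, y ∈ A → z ∈ Z ∧ f z = y := by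
      intro y
      by_cases hy : y ∈ A
      · obtain ⟨z, hz⟩ := hAW hy
        exact ⟨z, fun _ => hz⟩
      · exact ⟨y, fun h => absurd h hy⟩
    choose l hl using this
    have hfl : ∀ x ∈ A.image l, f x ∈ Y := by
      intro x hx
      obtain ⟨z, hz, rfl⟩ := Finset.mem_image.1 hx
      rw [(hl z hz).2]
      exact z.2
    have h1 := ha (A.image l) (by
      rw [Finset.card_image_of_injOn, hAn]
      intro p hp q hq hpq
      apply Subtype.ext
      rw [← (hl p hp).2, ← (hl q hq).2, hpq]) (by
      intro x hx
      obtain ⟨z, hz, rfl⟩ := Finset.mem_image.1 (Finset.mem_coe.1 hx)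
      exact (hl z hz).1) (by
      intro x hx
      obtain ⟨z, hz, rfl⟩ := Finset.mem_image.1 hx
      refine hE.trans (hAE z hz) (hE.symm ?_)
      have := hfE (l z)
      rwa [(hl z hz).2] at this)
    rw [← h1]
    simp only [c1, if_pos hfl]
    congr 1
    ext y
    simp only [Finset.mem_subtype, Finset.mem_image]
    constructor
    · intro hy
      exact ⟨l y, ⟨y, hy, rfl⟩, (hl y hy).2⟩
    · rintro ⟨_, ⟨z, hz, rfl⟩, h2⟩
      rw [(hl z hz).2] at h2
      rwa [← Subtype.ext h2]

/-- `n` is the first index enumerating an element of `Y`. -/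
def auxFirst {X : Type*} (h : ℕ → X → X) (Y : Set X) (s : X) (n : ℕ) : Prop :=
  h n s ∈ Y ∧ ∀ m < n, h m s ≠ h n s

theorem aux_first_meas {X : Type*} [MeasurableSpace X] [StandardBorelSpace X]
    (h : ℕ → X → X) (hh : ∀ n, Measurable (h n)) (Y : Set X) (hY : MeasurableSet Y) (n : ℕ) :
    MeasurableSet {s | auxFirst h Y s n} := by
  refine MeasurableSet.inter (hh n hY) ?_
  change MeasurableSet {s | ∀ m < n, h m s ≠ h n s}
  have : {s | ∀ m < n, h m s ≠ h n s} = ⋂ m, ⋂ (_ : m < n), {s | h m s = h n s}ᶜ := by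
    ext; simp
  rw [this]
  exact MeasurableSet.iInter fun m => MeasurableSet.iInter fun _ =>
    (measurableSet_eq_fun (hh m) (hh n)).compl

theorem aux_count_meas {X : Type*} [MeasurableSpace X] [StandardBorelSpace X]
    (h : ℕ → X → X) (hh : ∀ n, Measurable (h n)) (Y : Set X) (hY : MeasurableSet Y) (n : ℕ) :
    Measurable fun s => Nat.count (auxFirst h Y s) n := by
  induction n with
  | zero => simp only [Nat.count_zero]; exact measurable_const
  | succ n ih =>
    simp only [Nat.count_succ]
    exact ih.add (Measurable.ite (aux_first_meas h hh Y hY n) measurable_const measurable_const)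

theorem aux_first_infinite {X : Type*} (h : ℕ → X → X) (Y : Set X) (s : X)
    (hinf : {y | y ∈ Y ∧ ∃ n, h n s = y}.Infinite) : {n | auxFirst h Y s n}.Infinite := by
  intro hfin
  refine hinf ((hfin.image fun n => h n s).subset ?_)
  rintro y ⟨hy, hn⟩
  have h1 := Nat.find_spec hn
  refine ⟨Nat.find hn, ⟨?_, ?_⟩, h1⟩
  · rw [h1]; exact hy
  · intro m hm
    rw [h1]
    exact Nat.find_min hn hm

end RamseyHelpers

/-- If `E →_B (E)^n_k` holds and `Y ⊆ X` is Borel with `F = E ↾ Y` aperiodic, then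
`F →_B (F)^n_k` holds. -/
theorem strong_borel_ramsey_restrict_subset {X : Type*} [MeasurableSpace X] [StandardBorelSpace X]
    (E : X → X → Prop) (hE : Equivalence E)
    (hEBorel : MeasurableSet {p : X × X | E p.1 p.2})
    (hcount : ∀ x : X, {y | E x y}.Countable)
    (haper : ∀ x : X, {y | E x y}.Infinite)
    (n k : ℕ) (hn : 1 < n) (hk : 1 < k)
    (Y : Set X) (hY : MeasurableSet Y)
    (hFaper : ∀ y : Y, {z : Y | E ↑y ↑z}.Infinite)
    (hRamsey : StrongBorelRamsey E n k) :
    StrongBorelRamsey (fun a b : Y => E a b) n k := by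
  intro c hc
  obtain ⟨h, hh, hh'⟩ := aux_enum E hE hEBorel hcount
  -- first push: a retraction into `Y`
  obtain ⟨f0, hf0, hf0'⟩ := aux_sel hh (R := fun n => h n ⁻¹' Y) (fun n => hh n hY)
  have hf0E : ∀ x, E x (f0 x) := by
    intro x
    rcases hf0' x with ⟨n, -, h1⟩ | ⟨-, h1⟩
    · exact (hh' _ _).2 ⟨n, h1.symm⟩
    · rw [h1]; exact hE.refl x
  have hf0Y : ∀ x y, E x y → y ∈ Y → f0 x ∈ Y := by
    intro x y hxy hy
    rcases hf0' x with ⟨n, h1, h2⟩ | ⟨h1, -⟩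
    · rw [h2]; exact h1
    · obtain ⟨n, hn⟩ := (hh' x y).1 hxy
      exact absurd (show x ∈ h n ⁻¹' Y by rw [Set.mem_preimage, hn]; exact hy) (h1 n)
  obtain ⟨Z0, hZ0, hW0, hW0m⟩ := aux_push E hE h hh hh' n k hk Y hY hRamsey c hc f0 hf0 hf0E
  set W0 : Set Y := {y : Y | ∃ z ∈ Z0, f0 z = y} with hW0def
  have hV0 : MeasurableSet (Subtype.val '' W0 : Set X) := hY.subtype_image hW0
  set V0 : Set X := Subtype.val '' W0 with hV0def
  -- the transversal
  let e : X → ℝ := MeasureTheory.embeddingReal X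
  have he : MeasurableEmbedding e := MeasureTheory.measurableEmbedding_embeddingReal X
  let T : Set X := {x | x ∈ V0 ∧ ∀ n, h n x ∈ V0 → e x ≤ e (h n x)}
  have hT : MeasurableSet T := by
    refine hV0.inter ?_
    change MeasurableSet {x | ∀ n, h n x ∈ V0 → e x ≤ e (h n x)}
    have : {x | ∀ n, h n x ∈ V0 → e x ≤ e (h n x)} =
        ⋂ n, ((h n ⁻¹' V0)ᶜ ∪ {x | e x ≤ e (h n x)}) := by
      ext x
      simp only [Set.mem_ofPred_eq, Set.mem_iInter, Set.mem_union, Set.mem_compl_iff,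
        Set.mem_preimage]
      exact forall_congr' fun n => imp_iff_not_or
    rw [this]
    exact MeasurableSet.iInter fun n => (hh n hV0).compl.union
      (measurableSet_le he.measurable (he.measurable.comp (hh n)))
  have hTu : ∀ a ∈ T, ∀ b ∈ T, E a b → a = b := by
    intro a ha b hb hab
    obtain ⟨i, hi⟩ := (hh' a b).1 hab
    obtain ⟨j, hj⟩ := (hh' b a).1 (hE.symm hab)
    have h1 := ha.2 i (by rw [hi]; exact hb.1)
    have h2 := hb.2 j (by rw [hj]; exact ha.1)
    rw [hi] at h1
    rw [hj] at h2
    exact he.injective (le_antisymm h1 h2)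
  have hTY : ∀ a ∈ T, a ∈ Y := by
    rintro a ⟨⟨y, -, rfl⟩, -⟩
    exact y.2
  let Q : Set X := ⋃ n, h n ⁻¹' T
  have hQ : MeasurableSet Q := MeasurableSet.iUnion fun n => hh n hT
  have hQiff : ∀ x, x ∈ Q ↔ ∃ s ∈ T, E x s := by
    intro x
    simp only [Q, Set.mem_iUnion, Set.mem_preimage]
    constructor
    · rintro ⟨n, hn⟩
      exact ⟨_, hn, (hh' _ _).2 ⟨n, rfl⟩⟩
    · rintro ⟨s, hs, hxs⟩
      obtain ⟨n, hn⟩ := (hh' _ _).1 hxs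
      exact ⟨n, by rw [hn]; exact hs⟩
  have hQinv : ∀ x y, E x y → (x ∈ Q ↔ y ∈ Q) := by
    intro x y hxy
    rw [hQiff, hQiff]
    constructor
    · rintro ⟨s, hs, h1⟩
      exact ⟨s, hs, hE.trans (hE.symm hxy) h1⟩
    · rintro ⟨s, hs, h1⟩
      exact ⟨s, hs, hE.trans hxy h1⟩
  -- off `Q`, the set `W0` is infinite
  have hinf0 : ∀ y : Y, (y : X) ∉ Q → {z : Y | z ∈ W0 ∧ E y z}.Infinite := by
    intro y hy hfin
    have hne : {z : Y | z ∈ W0 ∧ E y z}.Nonempty := by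
      obtain ⟨z, hz, hyz⟩ := (hZ0 y).nonempty
      exact ⟨⟨f0 z, hf0Y z y (hE.symm hyz) y.2⟩, ⟨z, hz, rfl⟩, hE.trans hyz (hf0E z)⟩
    obtain ⟨s, hs, hmin⟩ := Set.exists_min_image _ (fun z : Y => e z) hfin hne
    apply hy
    rw [hQiff]
    refine ⟨s, ⟨⟨s, hs.1, rfl⟩, ?_⟩, hs.2⟩
    rintro m ⟨z, hz, hzm⟩
    rw [← hzm]
    refine hmin z ⟨hz, hE.trans hs.2 ((hh' _ _).2 ⟨m, hzm.symm⟩)⟩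
  obtain ⟨t, ht, ht'⟩ := aux_sel hh (R := fun n => h n ⁻¹' T) (fun n => hh n hT)
  have htQ : ∀ x ∈ Q, t x ∈ T ∧ E x (t x) := by
    intro x hx
    rcases ht' x with ⟨n, h1, h2⟩ | ⟨h1, -⟩
    · rw [h2]; exact ⟨h1, (hh' _ _).2 ⟨n, rfl⟩⟩
    · obtain ⟨n, hn⟩ := Set.mem_iUnion.1 hx
      exact absurd hn (h1 n)
  let R : ℕ → Set X := fun n => Q ∩ ({x | auxFirst h Y (t x) n} ∩
    {x | h (Nat.count (auxFirst h Y (t x)) n) (t x) = x})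
  have hR : ∀ n, MeasurableSet (R n) := by
    intro n
    refine hQ.inter (MeasurableSet.inter (ht (aux_first_meas h hh Y hY n)) ?_)
    have : {x | h (Nat.count (auxFirst h Y (t x)) n) (t x) = x} =
        ⋃ r, ({x | Nat.count (auxFirst h Y (t x)) n = r} ∩ {x | h r (t x) = x}) := by
      ext x; simp
    rw [this]
    refine MeasurableSet.iUnion fun r => MeasurableSet.inter ?_ ?_
    · exact ((aux_count_meas h hh Y hY n).comp ht) (measurableSet_singleton r)
    · exact measurableSet_eq_fun ((hh r).comp ht) measurable_id
  obtain ⟨f1, hf1, hf1'⟩ := aux_sel (g := fun n x => h n (t x)) (fun n => (hh n).comp ht) hR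
  have hf1E : ∀ x, E x (f1 x) := by
    intro x
    rcases hf1' x with ⟨n, h1, h2⟩ | ⟨-, h1⟩
    · rw [h2]
      exact hE.trans (htQ x h1.1).2 ((hh' _ _).2 ⟨n, rfl⟩)
    · rw [h1]; exact hE.refl x
  have hf1Q : ∀ x ∈ Q, ∃ n, x ∈ R n ∧ f1 x = h n (t x) := by
    intro x hx
    rcases hf1' x with h1 | ⟨h1, -⟩
    · exact h1
    · exfalso
      obtain ⟨g1, g2⟩ := htQ x hx
      obtain ⟨r, hr⟩ := (hh' _ _).1 (hE.symm g2)
      have hinf : {n | auxFirst h Y (t x) n}.Infinite := by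
        apply aux_first_infinite
        intro hfin
        refine hFaper ⟨t x, hTY _ g1⟩ ?_
        refine Set.Finite.of_finite_image (f := Subtype.val) (hfin.subset ?_)
          Subtype.val_injective.injOn
        rintro _ ⟨z, hz, rfl⟩
        exact ⟨z.2, (hh' _ _).1 hz⟩
      refine h1 (Nat.nth (auxFirst h Y (t x)) r) ⟨hx, Nat.nth_mem_of_infinite hinf r, ?_⟩
      change h (Nat.count (auxFirst h Y (t x)) (Nat.nth (auxFirst h Y (t x)) r)) (t x) = x
      rw [Nat.count_nth_of_infinite hinf]
      exact hr
  have hf1Y : ∀ x ∈ Q, f1 x ∈ Y := by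
    intro x hx
    obtain ⟨n, h1, h2⟩ := hf1Q x hx
    rw [h2]
    exact h1.2.1.1
  have hf1inj : ∀ x ∈ Q, ∀ x' ∈ Q, E x x' → f1 x = f1 x' → x = x' := by
    intro x hx x' hx' hxx heq
    obtain ⟨n, h1, h2⟩ := hf1Q x hx
    obtain ⟨n', h1', h2'⟩ := hf1Q x' hx'
    have htt : t x = t x' := hTu _ (htQ x hx).1 _ (htQ x' hx').1
      (hE.trans (hE.symm (htQ x hx).2) (hE.trans hxx (htQ x' hx').2))
    obtain ⟨-, a1, a2⟩ := h1
    obtain ⟨-, b1, b2⟩ := h1'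
    simp only [Set.mem_ofPred_eq] at a1 a2 b1 b2
    rw [h2, h2', ← htt] at heq
    rw [← htt] at b1 b2
    have hnn : n = n' := by
      rcases lt_trichotomy n n' with hlt | hlt | hlt
      · exact absurd heq (b1.2 n hlt)
      · exact hlt
      · exact absurd heq.symm (a1.2 n' hlt)
    rw [← a2, ← b2, hnn]
  obtain ⟨Z1, hZ1, hW1, hW1m⟩ := aux_push E hE h hh hh' n k hk Y hY hRamsey c hc f1 hf1 hf1E
  set W1 : Set Y := {y : Y | ∃ z ∈ Z1, f1 z = y} with hW1def
  have hinf1 : ∀ y : Y, (y : X) ∈ Q → {z : Y | z ∈ W1 ∧ E y z}.Infinite := by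
    intro y hy hfin
    refine hZ1 y (Set.Finite.of_finite_image (f := f1)
      ((hfin.image Subtype.val).subset ?_) ?_)
    · rintro _ ⟨z, ⟨hz, hyz⟩, rfl⟩
      exact ⟨⟨f1 z, hf1Y z ((hQinv _ _ hyz).1 hy)⟩, ⟨⟨z, hz, rfl⟩, hE.trans hyz (hf1E z)⟩, rfl⟩
    · rintro a ⟨-, ha⟩ b ⟨-, hb⟩ hab
      exact hf1inj a ((hQinv _ _ ha).1 hy) b ((hQinv _ _ hb).1 hy)
        (hE.trans (hE.symm ha) hb) hab
  have hQY : MeasurableSet (Subtype.val ⁻¹' Q : Set Y) := measurable_subtype_coe hQ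
  refine ⟨(Subtype.val ⁻¹' Q ∩ W1) ∪ ((Subtype.val ⁻¹' Q)ᶜ ∩ W0),
    (hQY.inter hW1).union (hQY.compl.inter hW0), ?_, ?_⟩
  · intro y
    by_cases hy : (y : X) ∈ Q
    · refine (hinf1 y hy).mono ?_
      rintro z ⟨hz, hyz⟩
      exact ⟨Or.inl ⟨(hQinv _ _ hyz).1 hy, hz⟩, hyz⟩
    · refine (hinf0 y hy).mono ?_
      rintro z ⟨hz, hyz⟩
      exact ⟨Or.inr ⟨fun h => hy ((hQinv _ _ hyz).2 h), hz⟩, hyz⟩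
  · intro y
    by_cases hy : (y : X) ∈ Q
    · obtain ⟨a, ha⟩ := hW1m y
      refine ⟨a, fun A h1 h2 h3 => ha A h1 (fun z hz => ?_) h3⟩
      rcases h2 hz with h4 | h4
      · exact h4.2
      · exact absurd ((hQinv _ _ (h3 z hz)).1 hy) h4.1
    · obtain ⟨a, ha⟩ := hW0m y
      refine ⟨a, fun A h1 h2 h3 => ha A h1 (fun z hz => ?_) h3⟩
      rcases h2 hz with h4 | h4
      · exact absurd ((hQinv _ _ (h3 z hz)).2 h4.1) hy
      · exact h4.2
end
end
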